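/- Let x ∈ Res(X), ξ ∈ Cr(X), and let A be an apartment containing the combinatorial sector Q(x,ξ). Then for all roots α₁,…,αₙ ∈ Φ_A(ξ), the intersection Q(x,ξ) ∩ { R ∈ Res(X) : R is contained in αᵢ for each i = 1,…,n } is non-empty. -/

import Mathlib

open Filter Topology

noncomputable section

variable {B : Type} {W : Type} [Group W] {M : CoxeterMatrix B}

/-- The subset `I` of the simple reflections is of *spherical type* if the standard
parabolic subgroup `W_I` it generates is finite. -/
def SphType (cs : CoxeterSystem M W) (I : Set B) : Prop :=
  ((Subgroup.closure (cs.simple '' I) : Subgroup W) : Set W).Finite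

/-- A building of type `(W,S)`, in the chamber-system (`W`-metric) approach:
a nonempty set of chambers with a Weyl-group-valued distance function `delta`. -/
structure Bldg (cs : CoxeterSystem M W) where
  Chamber : Type
  chamber_nonempty : Nonempty Chamber
  delta : Chamber → Chamber → W
  delta_eq_one_iff : ∀ C D, delta C D = 1 ↔ C = D
  delta_mem_pair : ∀ C D E (i : B), delta D E = cs.simple i →
    delta C E = delta C D * cs.simple i ∨ delta C E = delta C D
  delta_eq_of_length : ∀ C D E (i : B), delta D E = cs.simple i →
    cs.length (delta C D * cs.simple i) = cs.length (delta C D) + 1 →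
    delta C E = delta C D * cs.simple i
  exists_delta : ∀ C D (i : B), ∃ E, delta D E = cs.simple i ∧
    delta C E = delta C D * cs.simple i

namespace Bldg

variable {cs : CoxeterSystem M W} (X : Bldg cs)

instance : Nonempty X.Chamber := X.chamber_nonempty

instance : TopologicalSpace X.Chamber := ⊥
instance : DiscreteTopology X.Chamber := ⟨rfl⟩

/-- The gallery distance between two chambers. -/
def gdist (C D : X.Chamber) : ℕ := cs.length (X.delta C D)

/-- The `I`-residue of the chamber `C`. -/
def residue (I : Set B) (C : X.Chamber) : Set X.Chamber :=
  {D | X.delta C D ∈ Subgroup.closure (cs.simple '' I)}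

/-- `R` is a spherical residue. -/
def IsSphResidue (R : Set X.Chamber) : Prop :=
  ∃ (I : Set B) (C : X.Chamber), SphType cs I ∧ R = X.residue I C

/-- `R` is a panel, i.e. an `{s}`-residue. -/
def IsPanel (R : Set X.Chamber) : Prop :=
  ∃ (i : B) (C : X.Chamber), R = X.residue {i} C

/-- The set `Res(X)` of spherical residues of `X`. -/
def Res : Type := {R : Set X.Chamber // X.IsSphResidue R}

/-- The set of panels of `X`. -/
def Panel : Type := {R : Set X.Chamber // X.IsPanel R}

instance : Nonempty X.Res := by
  obtain ⟨C⟩ := X.chamber_nonempty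
  exact ⟨⟨X.residue ∅ C, ∅, C, by simp [SphType], rfl⟩⟩

instance : TopologicalSpace X.Res := ⊥
instance : DiscreteTopology X.Res := ⟨rfl⟩

/-- `R₁ ≤ R₂` : the spherical residue `R₂` contains `R₁`, i.e. `R₂ ⊆ R₁` as
sets of chambers. -/
def leRes (R₁ R₂ : X.Res) : Prop := R₂.1 ⊆ R₁.1

/-- The star `St(σ)` of a spherical residue. -/
def star (σ : X.Res) : Set X.Res := {τ | X.leRes σ τ}

/-- The gate (combinatorial projection) of the chamber `C` onto the residue `R` :
the unique chamber of `R` through which pass minimal galleries from `C` to any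
chamber of `R`. -/
def gate (R : Set X.Chamber) (C : X.Chamber) : X.Chamber :=
  Classical.epsilon fun D => D ∈ R ∧ ∀ E ∈ R, X.gdist C E = X.gdist C D + X.gdist D E

/-- The combinatorial projection of the residue `T` onto the residue `R`,
as a set of chambers. -/
def projSet (R T : Set X.Chamber) : Set X.Chamber := X.gate R '' T

/-- The combinatorial projection `proj_R(T)` of the spherical residue `T` onto
the spherical residue `R`, as a spherical residue. -/
def projRes (R T : X.Res) : X.Res :=
  Classical.epsilon fun U : X.Res => U.1 = X.projSet R.1 T.1

/-- The map `proj_r : Res(X) → ∏_σ St(σ)` underlying the maximal combinatorial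
bordification. -/
def projr (R : X.Res) : X.Res → X.Res := fun σ => X.projRes σ R

/-- The maximal combinatorial bordification `Cr(X)`: the closure of the image
of `proj_r`, each factor of the product being discrete. -/
def Cr : Set (X.Res → X.Res) := closure (Set.range X.projr)

/-- The map `proj_c : ch(X) → ∏_{σ panel} St(σ)` underlying the minimal
combinatorial bordification. -/
def projc (C : X.Chamber) : X.Panel → X.Chamber := fun σ => X.gate σ.1 C

/-- The minimal combinatorial bordification `Cc(X)`. -/
def Cc : Set (X.Panel → X.Chamber) := closure (Set.range X.projc)

/-- A set of spherical residues is closed if it contains, with any residue,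
all residues that it contains (in the order `leRes`). -/
def ClosedResSet (𝓡 : Set X.Res) : Prop :=
  ∀ R₁ R₂ : X.Res, X.leRes R₁ R₂ → R₂ ∈ 𝓡 → R₁ ∈ 𝓡

/-- A set of spherical residues is convex if it is closed and stable under
combinatorial projections. -/
def ConvexResSet (𝓡 : Set X.Res) : Prop :=
  X.ClosedResSet 𝓡 ∧ ∀ R₁ ∈ 𝓡, ∀ R₂ ∈ 𝓡, X.projRes R₁ R₂ ∈ 𝓡

/-- The closure of a set of spherical residues. -/
def resClosure (𝓡 : Set X.Res) : Set X.Res := ⋂₀ {𝓢 | X.ClosedResSet 𝓢 ∧ 𝓡 ⊆ 𝓢}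

/-- The convex hull of a set of spherical residues. -/
def convHull (𝓡 : Set X.Res) : Set X.Res := ⋂₀ {𝓢 | X.ConvexResSet 𝓢 ∧ 𝓡 ⊆ 𝓢}

/-- The convex hull `Conv(R₁,R₂)` of two spherical residues. -/
def conv2 (R₁ R₂ : X.Res) : Set X.Res := X.convHull {R₁, R₂}

/-- `α : W → ch(X)` is an apartment map: an isometric embedding of the Coxeter
complex. -/
def IsApartMap (α : W → X.Chamber) : Prop :=
  Function.Injective α ∧ ∀ v w : W, X.delta (α v) (α w) = v⁻¹ * w

/-- `A` is an apartment of `X`. -/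
def IsApartment (A : Set X.Chamber) : Prop :=
  ∃ α : W → X.Chamber, X.IsApartMap α ∧ A = Set.range α

/-- The residue `R` lies in the apartment `A`. -/
def LiesIn (R : X.Res) (A : Set X.Chamber) : Prop := (R.1 ∩ A).Nonempty

/-- `φ` is a root (half-apartment) of the apartment `A`. -/
def IsRootOf (A φ : Set X.Chamber) : Prop :=
  ∃ α : W → X.Chamber, X.IsApartMap α ∧ A = Set.range α ∧
    ∃ t : W, cs.IsReflection t ∧ φ = α '' {v : W | cs.length v < cs.length (t * v)}

/-- The residue `R` is contained in the root `φ` of the apartment `A`. -/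
def ContainedInRoot (R : X.Res) (A φ : Set X.Chamber) : Prop := R.1 ∩ A ⊆ φ

/-- `Φ_A(R₁,R₂)`: the set of roots of `A` containing `R₁` but not `R₂`. -/
def PhiSep (A : Set X.Chamber) (R₁ R₂ : X.Res) : Set (Set X.Chamber) :=
  {φ | X.IsRootOf A φ ∧ X.ContainedInRoot R₁ A φ ∧ ¬ X.ContainedInRoot R₂ A φ}

/-- A choice of apartment in which both `R₁` and `R₂` lie. -/
def chooseApt (R₁ R₂ : X.Res) : Set X.Chamber :=
  Classical.epsilon fun A : Set X.Chamber => X.IsApartment A ∧ X.LiesIn R₁ A ∧ X.LiesIn R₂ A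

/-- The root-distance between two spherical residues:
`d(R₁,R₂) = ½|Φ_A(R₁,R₂)| + ½|Φ_A(R₂,R₁)|` for an apartment `A` containing both. -/
def rootDist (R₁ R₂ : X.Res) : ℝ :=
  (((X.PhiSep (X.chooseApt R₁ R₂) R₁ R₂).ncard +
    (X.PhiSep (X.chooseApt R₁ R₂) R₂ R₁).ncard : ℕ) : ℝ) / 2

/-- The interval `[R₁,R₂]` determined by two spherical residues. -/
def interval (R₁ R₂ : X.Res) : Set X.Res :=
  {σ | X.rootDist R₁ R₂ = X.rootDist R₁ σ + X.rootDist σ R₂}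

/-- The retraction onto the apartment given by the apartment map `α`, centred at
the chamber `α 1`. -/
def retr (α : W → X.Chamber) (D : X.Chamber) : X.Chamber := α (X.delta (α 1) D)

/-- The retraction onto an apartment, acting on spherical residues: it maps the
`I`-residue of a chamber `D` to the `I`-residue of the retracted chamber. -/
def retrRes (α : W → X.Chamber) (R : X.Res) : X.Res :=
  Classical.epsilon fun T : X.Res =>
    ∃ (I : Set B) (D : X.Chamber), R.1 = X.residue I D ∧ T.1 = X.residue I (X.retr α D)

/-- The sequence `(R_n)` of spherical residues converges to `ξ` in the maximal
combinatorial bordification. -/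
def ConvSeq (ξ : X.Res → X.Res) (R : ℕ → X.Res) : Prop :=
  Tendsto (fun n => X.projr (R n)) atTop (nhds ξ)

/-- `Q(x, (R_n)) = ⋃_k ⋂_{n ≥ k} Conv(x, R_n)`. -/
def Qseq (x : X.Res) (R : ℕ → X.Res) : Set X.Res :=
  ⋃ k : ℕ, ⋂ n : ℕ, ⋂ _ : k ≤ n, X.conv2 x (R n)

/-- The combinatorial sector `Q(x,ξ)` based at `x` and pointing towards `ξ`. -/
def Qsector (x : X.Res) (ξ : X.Res → X.Res) : Set X.Res :=
  X.Qseq x (Classical.epsilon (X.ConvSeq ξ))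

/-- `Φ_A(ξ)`: the set of roots of the apartment `A` (with apartment map `α`) in
which every sequence of residues converging to `ξ`, retracted to `A`, eventually
lies. -/
def PhiXi (A : Set X.Chamber) (α : W → X.Chamber) (ξ : X.Res → X.Res) :
    Set (Set X.Chamber) :=
  {φ | X.IsRootOf A φ ∧ ∀ R : ℕ → X.Res, X.ConvSeq ξ R →
    ∃ N : ℕ, ∀ n > N, X.ContainedInRoot (X.retrRes α (R n)) A φ}

/-- `Φ_A(x)`: the set of roots of `A` containing the residue `x`. -/
def PhiRes (A : Set X.Chamber) (x : X.Res) : Set (Set X.Chamber) :=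
  {φ | X.IsRootOf A φ ∧ X.ContainedInRoot x A φ}

/-- The spherical residue `x` is a chamber (an `∅`-residue). -/
def IsChamberRes (x : X.Res) : Prop :=
  ∃ C : X.Chamber, x.1 = X.residue (∅ : Set B) C

/-- The automorphism group of the building: all permutations of the chambers
preserving the Weyl distance. -/
def autGroup : Subgroup (Equiv.Perm X.Chamber) where
  carrier := {g | ∀ C D : X.Chamber, X.delta (g C) (g D) = X.delta C D}
  one_mem' := by intro C D; simp
  mul_mem' := by
    intro a b ha hb C D
    simp only [Equiv.Perm.mul_apply]
    rw [ha, hb]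
  inv_mem' := by
    intro a ha C D
    have := ha (a⁻¹ C) (a⁻¹ D)
    simpa using this.symm

/-- `Aut(X)` as a type. -/
abbrev Aut : Type := ↥X.autGroup

/-- The topology of pointwise convergence on `Aut(X)` (the chamber set being
discrete). -/
instance : TopologicalSpace X.Aut :=
  TopologicalSpace.induced
    (fun g : X.Aut => ((g : Equiv.Perm X.Chamber) : X.Chamber → X.Chamber)) inferInstance

/-- The action of an automorphism on spherical residues. -/
def actRes (g : X.Aut) (R : X.Res) : X.Res :=
  Classical.epsilon fun T : X.Res => T.1 = (g : Equiv.Perm X.Chamber) '' R.1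

/-- The action of an automorphism on panels. -/
def actPanel (g : X.Aut) (σ : X.Panel) : X.Panel :=
  haveI : Nonempty X.Panel := ⟨σ⟩
  Classical.epsilon fun τ : X.Panel => τ.1 = (g : Equiv.Perm X.Chamber) '' σ.1

/-- The action of `Aut(X)` on the maximal combinatorial bordification:
`(g·f)(σ) = g·f(g⁻¹σ)`. -/
def actCr (g : X.Aut) (f : X.Res → X.Res) : X.Res → X.Res :=
  fun σ => X.actRes g (f (X.actRes g⁻¹ σ))

/-- The action of `Aut(X)` on the minimal combinatorial bordification. -/
def actCc (g : X.Aut) (f : X.Panel → X.Chamber) : X.Panel → X.Chamber :=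
  fun σ => (g : Equiv.Perm X.Chamber) (f (X.actPanel g⁻¹ σ))

/-- The building is locally finite: `S` is finite and panels are finite. -/
def LocallyFinite : Prop :=
  Finite B ∧ ∀ R : Set X.Chamber, X.IsPanel R → R.Finite

/-- The building is thick: every panel contains at least three chambers. -/
def Thick : Prop := ∀ R : Set X.Chamber, X.IsPanel R → 3 ≤ R.ncard

/-- The subgroup `G ≤ Aut(X)` acts strongly transitively: transitively on pairs
`(C, A)` of a chamber contained in an apartment. -/
def StronglyTransitive (G : Subgroup X.Aut) : Prop :=
  ∀ (C C' : X.Chamber) (A A' : Set X.Chamber),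
    X.IsApartment A → C ∈ A → X.IsApartment A' → C' ∈ A' →
    ∃ g ∈ G, (g : Equiv.Perm X.Chamber) C = C' ∧ (g : Equiv.Perm X.Chamber) '' A = A'

end Bldg

/-- A topological group is amenable if there is a left-invariant mean on the
space of bounded continuous real-valued functions on it. -/
def IsAmenableGroup (H : Type*) [Group H] [TopologicalSpace H] : Prop :=
  ∃ m : BoundedContinuousFunction H ℝ →ₗ[ℝ] ℝ,
    m 1 = 1 ∧ (∀ f : BoundedContinuousFunction H ℝ, (∀ x, 0 ≤ f x) → 0 ≤ m f) ∧
    ∀ (g : H) (f₁ f₂ : BoundedContinuousFunction H ℝ),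
      (∀ x, f₂ x = f₁ (g * x)) → m f₂ = m f₁

/-- A subset `K` of a topological group is topologically locally finite if every
finite subset of `K` generates a subgroup with compact closure. -/
def IsTLFSet {H : Type*} [Group H] [TopologicalSpace H] (K : Set H) : Prop :=
  ∀ s : Finset H, (s : Set H) ⊆ K →
    IsCompact (closure ((Subgroup.closure (s : Set H) : Subgroup H) : Set H))

/-- The space of closed subgroups of a topological group. -/
def ChabautySpace (H : Type*) [Group H] [TopologicalSpace H] : Type _ :=
  {K : Subgroup H // IsClosed (K : Set H)}

instance {H : Type*} [Group H] [TopologicalSpace H] : Nonempty (ChabautySpace H) :=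
  ⟨⟨⊤, by rw [Subgroup.coe_top]; exact isClosed_univ⟩⟩

/-- The Chabauty topology on the space of closed subgroups. -/
instance {H : Type*} [Group H] [TopologicalSpace H] : TopologicalSpace (ChabautySpace H) :=
  TopologicalSpace.generateFrom
    ({s | ∃ K : Set H, IsCompact K ∧ s = {L : ChabautySpace H | (L.1 : Set H) ∩ K = ∅}} ∪
     {s | ∃ U : Set H, IsOpen U ∧ s = {L : ChabautySpace H | ((L.1 : Set H) ∩ U).Nonempty}})

namespace Bldg

variable {cs : CoxeterSystem M W} (X : Bldg cs)

/-- The stabiliser in `G` of a spherical residue, as a set. -/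
def gstab (G : Subgroup X.Aut) (R : X.Res) : Set ↥G :=
  {g : ↥G | X.actRes (g : X.Aut) R = R}

/-- The stabiliser in `G` of a spherical residue, as a closed subgroup of `G`. -/
def gstabC (G : Subgroup X.Aut) (R : X.Res) : ChabautySpace ↥G :=
  Classical.epsilon fun L : ChabautySpace ↥G => (L.1 : Set ↥G) = X.gstab G R

/-- `D_ξ`: the union over `x ∈ Res(X)` of the pointwise fixators in `G` of the
combinatorial sectors `Q(x,ξ)`. -/
def gfixSector (G : Subgroup X.Aut) (ξ : X.Res → X.Res) : Set ↥G :=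
  {g : ↥G | ∃ x : X.Res, ∀ R ∈ X.Qsector x ξ, X.actRes (g : X.Aut) R = R}

/-- `D_ξ` as a closed subgroup of `G` (an element of the Chabauty space). -/
def DxiC (G : Subgroup X.Aut) (ξ : X.Res → X.Res) : ChabautySpace ↥G :=
  Classical.epsilon fun L : ChabautySpace ↥G => (L.1 : Set ↥G) = X.gfixSector G ξ

/-- The set of periodic elements of the stabiliser `G_ξ`. -/
def periodicStab (G : Subgroup X.Aut) (ξ : X.Res → X.Res) : Set ↥G :=
  {g : ↥G | X.actCr (g : X.Aut) ξ = ξ ∧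
    IsCompact (closure ((Subgroup.zpowers g : Subgroup ↥G) : Set ↥G))}

/-- The horofunction compactification of the chamber graph, with base point `y₀`. -/
def horoCh (y₀ : X.Chamber) : Set (X.Chamber → ℝ) :=
  closure (Set.range fun C : X.Chamber =>
    fun y : X.Chamber => (X.gdist C y : ℝ) - (X.gdist C y₀ : ℝ))

/-- The horofunction compactification of `(Res(X), root-distance)`, with base
point `z₀`. -/
def horoRes (z₀ : X.Res) : Set (X.Res → ℝ) :=
  closure (Set.range fun R : X.Res =>
    fun y : X.Res => X.rootDist R y - X.rootDist R z₀)

/-- The action of `Aut(X)` on horofunctions of the chamber graph. -/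
def actHoroCh (y₀ : X.Chamber) (g : X.Aut) (h : X.Chamber → ℝ) : X.Chamber → ℝ :=
  fun y => h (((g⁻¹ : X.Aut) : Equiv.Perm X.Chamber) y) -
    h (((g⁻¹ : X.Aut) : Equiv.Perm X.Chamber) y₀)

/-- The action of `Aut(X)` on horofunctions of `(Res(X), root-distance)`. -/
def actHoroRes (z₀ : X.Res) (g : X.Aut) (h : X.Res → ℝ) : X.Res → ℝ :=
  fun y => h (X.actRes g⁻¹ y) - h (X.actRes g⁻¹ z₀)

end Bldg

namespace CoxeterSystem

variable (cs : CoxeterSystem M W)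

open Classical in
/-- The involution of `W × ZMod 2` attached to a simple reflection `s i`: it conjugates the first
component by `s i` and flips the sign when the first component is `s i`. -/
def signPerm (i : B) : Equiv.Perm (W × ZMod 2) :=
  Function.Involutive.toPerm
    (fun p => (cs.simple i * p.1 * cs.simple i, p.2 + if p.1 = cs.simple i then 1 else 0)) <| by
    rintro ⟨t, e⟩
    have h : cs.simple i * t * cs.simple i = cs.simple i ↔ t = cs.simple i := by
      constructor
      · intro h
        have := congrArg (fun z => cs.simple i * (z * cs.simple i)) h
        simpa [mul_assoc] using this
      · rintro rfl
        simp
    ext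
    · simp [mul_assoc]
    · simp only [h]
      split_ifs
      · rw [add_assoc, CharTwo.add_self_eq_zero, add_zero]
      · simp

open Classical in
theorem signPerm_apply (i : B) (p : W × ZMod 2) :
    cs.signPerm i p =
      (cs.simple i * p.1 * cs.simple i, p.2 + if p.1 = cs.simple i then 1 else 0) := rfl

open Classical in
theorem signPerm_mul_pow_apply (i j : B) (k : ℕ) (t : W) (e : ZMod 2) :
    ((cs.signPerm i * cs.signPerm j) ^ k) (t, e) =
      ((cs.simple i * cs.simple j) ^ k * t * ((cs.simple i * cs.simple j) ^ k)⁻¹,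
        e + ∑ l ∈ Finset.range (2 * k),
          if t = ((cs.simple i * cs.simple j) ^ l)⁻¹ * cs.simple j then 1 else 0) := by
  set r := cs.simple i * cs.simple j with hr
  have hj : ∀ l : ℕ, r ^ l * cs.simple j = cs.simple j * (r ^ l)⁻¹ := by
    intro l
    induction l with
    | zero => simp
    | succ l ih =>
      have h : r * cs.simple j = cs.simple j * r⁻¹ := by simp [hr, mul_assoc]
      rw [pow_succ, mul_assoc, h, ← mul_assoc, ih, mul_assoc, ← mul_inv_rev, ← pow_succ',
        pow_succ]
  have hj' : ∀ l : ℕ, (r ^ l)⁻¹ * cs.simple j = cs.simple j * r ^ l := by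
    intro l
    rw [inv_mul_eq_iff_eq_mul, ← mul_assoc, hj, inv_mul_cancel_right]
  induction k with
  | zero => simp
  | succ k ih =>
    rw [pow_succ', Equiv.Perm.mul_apply, ih, Equiv.Perm.mul_apply, signPerm_apply, signPerm_apply]
    ext
    · simp [pow_succ', mul_assoc, hr]
    · have h1 : r ^ k * t * (r ^ k)⁻¹ = cs.simple j ↔ t = (r ^ (2 * k))⁻¹ * cs.simple j := by
        rw [mul_inv_eq_iff_eq_mul, ← eq_inv_mul_iff_mul_eq, ← hj', two_mul, pow_add,
          mul_inv_rev, mul_assoc]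
      have h2 : cs.simple j * (r ^ k * t * (r ^ k)⁻¹) * cs.simple j = cs.simple i ↔
          t = (r ^ (2 * k + 1))⁻¹ * cs.simple j := by
        have h3 : (r ^ (2 * k + 1))⁻¹ * cs.simple j =
            (r ^ k)⁻¹ * cs.simple j * cs.simple i * cs.simple j * r ^ k := by
          have : (r ^ (2 * k + 1))⁻¹ * cs.simple j = (r ^ k)⁻¹ * (r⁻¹ * ((r ^ k)⁻¹ * cs.simple j)) := by
            rw [show 2 * k + 1 = k + 1 + k by ring, pow_add, pow_succ]
            simp [mul_assoc]
          have h4 : r⁻¹ = cs.simple j * cs.simple i := by simp [hr]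
          rw [this, show (r ^ k)⁻¹ * cs.simple j * cs.simple i * cs.simple j * r ^ k =
            (r ^ k)⁻¹ * (r⁻¹ * (cs.simple j * r ^ k)) by simp only [h4, mul_assoc], hj']
        rw [h3]
        constructor
        · intro h
          have := congrArg (fun z => (r ^ k)⁻¹ * cs.simple j * z * cs.simple j * r ^ k) h
          simpa [mul_assoc] using this
        · rintro rfl
          simp [mul_assoc]
      simp only [h1, h2, show 2 * (k + 1) = 2 * k + 1 + 1 by ring, Finset.sum_range_succ]
      simp only [add_assoc]

theorem signPerm_isLiftable : M.IsLiftable cs.signPerm := by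
  classical
  intro i j
  ext1 ⟨t, e⟩
  rw [signPerm_mul_pow_apply, cs.simple_mul_simple_pow, two_mul, Finset.sum_range_add]
  have : ∀ l, (cs.simple i * cs.simple j) ^ (M i j + l) = (cs.simple i * cs.simple j) ^ l := by
    intro l
    rw [pow_add, cs.simple_mul_simple_pow, one_mul]
  simp only [this, CharTwo.add_self_eq_zero]
  simp

/-- The action of `W` on `W × ZMod 2` by signed conjugation. -/
def signHom : W →* Equiv.Perm (W × ZMod 2) := cs.lift ⟨cs.signPerm, cs.signPerm_isLiftable⟩

theorem signHom_simple (i : B) : cs.signHom (cs.simple i) = cs.signPerm i :=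
  cs.lift_apply_simple cs.signPerm_isLiftable i

theorem signHom_apply_eq (w t : W) (e : ZMod 2) :
    cs.signHom w (t, e) = (w * t * w⁻¹, e + (cs.signHom w (t, 0)).2) := by
  classical
  suffices h : (∀ e, (cs.signHom w (t, e)).1 = w * t * w⁻¹) ∧
      ∀ e, (cs.signHom w (t, e)).2 = e + (cs.signHom w (t, 0)).2 by
    exact Prod.ext (h.1 e) (h.2 e)
  induction w using cs.simple_induction_left with
  | one => simp
  | mul_simple_left w i ih =>
    simp only [map_mul, Equiv.Perm.mul_apply, signHom_simple, signPerm_apply, ih.1]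
    refine ⟨fun e => by simp [mul_assoc], fun e => ?_⟩
    rw [ih.2 e, add_assoc]

/-- The reflection cocycle: `sign w t` is `1` exactly when the reflection `t` is a right inversion
of `w`. -/
def sign (w t : W) : ZMod 2 := (cs.signHom w (t, 0)).2

theorem sign_mul (v w t : W) : cs.sign (v * w) t = cs.sign w t + cs.sign v (w * t * w⁻¹) := by
  unfold sign
  rw [map_mul, Equiv.Perm.mul_apply, signHom_apply_eq cs w t 0, signHom_apply_eq cs v]

theorem sign_one (t : W) : cs.sign 1 t = 0 := by simp [sign]

open Classical in
theorem sign_simple (i : B) (t : W) :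
    cs.sign (cs.simple i) t = if t = cs.simple i then 1 else 0 := by
  simp [sign, signHom_simple, signPerm_apply]

theorem sign_self {t : W} (ht : cs.IsReflection t) : cs.sign t t = 1 := by
  obtain ⟨w, i, rfl⟩ := ht
  have h := cs.sign_mul w w⁻¹ (w * cs.simple i * w⁻¹)
  have e : w⁻¹ * (w * cs.simple i * w⁻¹) * w⁻¹⁻¹ = cs.simple i := by simp [mul_assoc]
  rw [mul_inv_cancel, sign_one, e] at h
  rw [sign_mul, e, sign_mul, sign_simple]
  simp only [inv_simple, simple_mul_simple_self, one_mul, if_true]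
  linear_combination -h

open Classical in
theorem sign_wordProd (ω : List B) (t : W) :
    cs.sign (cs.wordProd ω) t = ((cs.rightInvSeq ω).count t : ZMod 2) := by
  induction ω with
  | nil => simp [sign_one]
  | cons i ω ih =>
    rw [wordProd_cons, sign_mul, ih, sign_simple, rightInvSeq, List.count_cons]
    have : (cs.wordProd ω) * t * (cs.wordProd ω)⁻¹ = cs.simple i ↔
        ((cs.wordProd ω)⁻¹ * cs.simple i * cs.wordProd ω == t) = true := by
      rw [beq_iff_eq]
      constructor
      · intro h
        rw [← h]
        simp [mul_assoc]
      · rintro rfl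
        simp [mul_assoc]
    simp only [this]
    push_cast
    congr

theorem isRightInversion_of_sign_eq_one {w t : W} (h : cs.sign w t = 1) :
    cs.IsRightInversion w t := by
  classical
  obtain ⟨ω, hω, rfl⟩ := cs.exists_isReduced w
  rw [sign_wordProd] at h
  refine cs.isRightInversion_of_mem_rightInvSeq hω ?_
  by_contra h'
  rw [List.count_eq_zero_of_not_mem h'] at h
  simp at h

theorem isRightInversion_iff_sign {w t : W} :
    cs.IsRightInversion w t ↔ cs.IsReflection t ∧ cs.sign w t = 1 := by
  refine ⟨fun h => ⟨h.1, ?_⟩, fun h => cs.isRightInversion_of_sign_eq_one h.2⟩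
  by_contra h'
  have h0 : cs.sign w t = 0 := by
    generalize cs.sign w t = z at *
    revert h'
    decide +revert
  have h1 : cs.sign (w * t) t = 1 := by
    rw [sign_mul, sign_self cs h.1, mul_inv_cancel_right, h0, add_zero]
  have := (cs.isRightInversion_of_sign_eq_one h1).2
  rw [mul_assoc, h.1.mul_self, mul_one] at this
  exact absurd this (not_lt.2 h.2.le)

theorem isRightInversion_mul_iff {v w t : W} (ht : cs.IsReflection t) :
    cs.IsRightInversion (v * w) t ↔
      ¬ (cs.IsRightInversion w t ↔ cs.IsRightInversion v (w * t * w⁻¹)) := by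
  simp only [isRightInversion_iff_sign, sign_mul, ht, ht.conj w, true_and]
  generalize cs.sign w t = a
  generalize cs.sign v _ = b
  revert a b
  decide

/-- The cocycle property of left inversions. -/
theorem isLeftInversion_mul_iff {v w t : W} (ht : cs.IsReflection t) :
    cs.IsLeftInversion (v * w) t ↔
      ¬ (cs.IsLeftInversion v t ↔ cs.IsLeftInversion w (v⁻¹ * t * v)) := by
  have := cs.isRightInversion_mul_iff (v := w⁻¹) (w := v⁻¹) ht
  rw [← mul_inv_rev, isRightInversion_inv_iff, isRightInversion_inv_iff,
    isRightInversion_inv_iff, inv_inv] at this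
  exact this

theorem mem_rightInvSeq_of_isRightInversion {ω : List B} {t : W}
    (h : cs.IsRightInversion (cs.wordProd ω) t) : t ∈ cs.rightInvSeq ω := by
  classical
  by_contra h'
  have := (cs.isRightInversion_iff_sign.1 h).2
  rw [sign_wordProd, List.count_eq_zero_of_not_mem h'] at this
  simp at this

theorem mem_leftInvSeq_of_isLeftInversion {ω : List B} {t : W}
    (h : cs.IsLeftInversion (cs.wordProd ω) t) : t ∈ cs.leftInvSeq ω := by
  rw [← isRightInversion_inv_iff, ← wordProd_reverse] at h
  have := cs.mem_rightInvSeq_of_isRightInversion h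
  rwa [rightInvSeq_reverse, List.mem_reverse] at this

end CoxeterSystem

namespace CoxeterSystem

variable (cs : CoxeterSystem M W)

/-- The set of simple reflections. -/
abbrev S : Set W := Set.range cs.simple

/-- The set of left inversions of an element. -/
def invSet (w : W) : Set W := {t | cs.IsLeftInversion w t}

variable {cs}

theorem IsReflection.of_mem_S {s : W} (hs : s ∈ cs.S) : cs.IsReflection s := by
  obtain ⟨i, rfl⟩ := hs
  exact cs.isReflection_simple i

theorem S_mul_self {s : W} (hs : s ∈ cs.S) : s * s = 1 := (IsReflection.of_mem_S hs).mul_self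

theorem S_inv {s : W} (hs : s ∈ cs.S) : s⁻¹ = s := (IsReflection.of_mem_S hs).inv

variable (cs)

theorem isReflection_of_mem_invSet {w t : W} (h : t ∈ cs.invSet w) : cs.IsReflection t := h.1

theorem isReflection_inv_conj {t : W} (w : W) :
    cs.IsReflection (w⁻¹ * t * w) ↔ cs.IsReflection t := by
  have := cs.isReflection_conj_iff w⁻¹ t
  rwa [inv_inv] at this

theorem mem_invSet_mul {v w t : W} :
    t ∈ cs.invSet (v * w) ↔ ¬ (t ∈ cs.invSet v ↔ v⁻¹ * t * v ∈ cs.invSet w) := by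
  by_cases ht : cs.IsReflection t
  · exact cs.isLeftInversion_mul_iff ht
  · have h1 : ∀ w, t ∉ cs.invSet w := fun w h => ht h.1
    have h2 : v⁻¹ * t * v ∉ cs.invSet w := fun h => ht ((cs.isReflection_inv_conj v).1 h.1)
    simp [h1, h2]

@[simp] theorem invSet_one : cs.invSet 1 = ∅ := by
  ext t
  simp [invSet, IsLeftInversion]

theorem mem_invSet_inv {w t : W} : t ∈ cs.invSet w⁻¹ ↔ w * t * w⁻¹ ∈ cs.invSet w := by
  have h := cs.mem_invSet_mul (v := w⁻¹) (w := w) (t := t)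
  simp only [inv_mul_cancel, invSet_one, Set.mem_empty_iff_false, inv_inv] at h
  tauto

theorem mem_invSet_iff {w t : W} (ht : cs.IsReflection t) :
    t ∈ cs.invSet w ↔ cs.length (t * w) < cs.length w := by
  simp [invSet, IsLeftInversion, ht]

variable {cs} in
theorem invSet_of_mem_S {s : W} (hs : s ∈ cs.S) : cs.invSet s = {s} := by
  obtain ⟨i, rfl⟩ := hs
  ext t
  constructor
  · intro h
    rw [← cs.wordProd_singleton] at h
    simpa using cs.mem_leftInvSeq_of_isLeftInversion h
  · rintro rfl
    simp [invSet, IsLeftInversion, cs.isReflection_simple]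

theorem invSet_wordProd_eq {ω : List B} (hω : cs.IsReduced ω) :
    cs.invSet (cs.wordProd ω) = {t | t ∈ cs.leftInvSeq ω} := by
  ext t
  exact ⟨cs.mem_leftInvSeq_of_isLeftInversion, cs.isLeftInversion_of_mem_leftInvSeq hω⟩

theorem finite_invSet (w : W) : (cs.invSet w).Finite := by
  obtain ⟨ω, hω, rfl⟩ := cs.exists_isReduced w
  rw [invSet_wordProd_eq cs hω]
  exact List.finite_toSet _

theorem ncard_invSet (w : W) : (cs.invSet w).ncard = cs.length w := by
  classical
  obtain ⟨ω, hω, rfl⟩ := cs.exists_isReduced w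
  rw [invSet_wordProd_eq cs hω, show {t | t ∈ cs.leftInvSeq ω} = ((cs.leftInvSeq ω).toFinset : Set W) by
    ext; simp, Set.ncard_coe_finset, List.toFinset_card_of_nodup hω.nodup_leftInvSeq,
    length_leftInvSeq, hω.eq]

theorem eq_one_of_invSet_eq_empty {w : W} (h : cs.invSet w = ∅) : w = 1 := by
  rw [← cs.length_eq_zero_iff, ← ncard_invSet, h, Set.ncard_empty]

theorem invSet_injective : Function.Injective cs.invSet := by
  intro a b h
  have : cs.invSet (a⁻¹ * b) = ∅ := by
    ext t
    have h1 := cs.mem_invSet_mul (v := a) (w := a⁻¹ * b) (t := a * t * a⁻¹)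
    have h2 : a⁻¹ * (a * t * a⁻¹) * a = t := by group
    rw [mul_inv_cancel_left, h, h2] at h1
    simp only [Set.mem_empty_iff_false, iff_false]
    tauto
  have := cs.eq_one_of_invSet_eq_empty this
  exact (inv_mul_eq_one.1 this)

theorem invSet_mul_subset (a b : W) :
    cs.invSet (a * b) ⊆ cs.invSet a ∪ (fun t => a * t * a⁻¹) '' cs.invSet b := by
  intro t ht
  rw [mem_invSet_mul] at ht
  by_cases h : t ∈ cs.invSet a
  · exact Or.inl h
  · refine Or.inr ⟨a⁻¹ * t * a, by tauto, by group⟩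

theorem ncard_conj_image (a b : W) :
    ((fun t => a * t * a⁻¹) '' cs.invSet b).ncard = cs.length b := by
  rw [Set.ncard_image_of_injective, ncard_invSet]
  intro x y h
  simpa using h

theorem length_mul_iff {a b : W} :
    cs.length (a * b) = cs.length a + cs.length b ↔
      ∀ t ∈ cs.invSet a, a⁻¹ * t * a ∉ cs.invSet b := by
  have hfa := cs.finite_invSet a
  have hfb : ((fun t => a * t * a⁻¹) '' cs.invSet b).Finite := (cs.finite_invSet b).image _
  constructor
  · intro h t ht htb
    have h1 : t ∈ cs.invSet a ∩ (fun t => a * t * a⁻¹) '' cs.invSet b :=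
      ⟨ht, a⁻¹ * t * a, htb, by group⟩
    have h2 := Set.ncard_union_add_ncard_inter _ _ hfa hfb
    have h3 : 0 < (cs.invSet a ∩ (fun t => a * t * a⁻¹) '' cs.invSet b).ncard :=
      (Set.ncard_pos (hfa.inter_of_left _)).2 ⟨t, h1⟩
    have h4 := Set.ncard_le_ncard (cs.invSet_mul_subset a b) (hfa.union hfb)
    rw [ncard_invSet, ncard_conj_image] at h2
    rw [ncard_invSet] at h4
    omega
  · intro h
    have h1 : cs.invSet (a * b) = cs.invSet a ∪ (fun t => a * t * a⁻¹) '' cs.invSet b := by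
      refine (cs.invSet_mul_subset a b).antisymm ?_
      rintro t (ht | ⟨t, ht, rfl⟩)
      · rw [mem_invSet_mul]
        have := h t ht
        tauto
      · have h2 : a⁻¹ * (a * t * a⁻¹) * a = t := by group
        rw [mem_invSet_mul]
        simp only [h2]
        have := h (a * t * a⁻¹)
        rw [h2] at this
        tauto
    rw [← ncard_invSet, h1, Set.ncard_union_eq _ hfa hfb, ncard_invSet, ncard_conj_image]
    rw [Set.disjoint_left]
    rintro t ht ⟨t, ht', rfl⟩
    refine h _ ht ?_
    rwa [show a⁻¹ * (a * t * a⁻¹) * a = t by group]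

theorem mem_invSet_iff_of_mul (v w t : W) :
    t ∈ cs.invSet w ↔ ¬ (t ∈ cs.invSet v ↔ v⁻¹ * t * v ∈ cs.invSet (v⁻¹ * w)) := by
  rw [← mem_invSet_mul, mul_inv_cancel_left]

theorem mem_invSet_mul_of_length {a b t : W}
    (h : cs.length (a * b) = cs.length a + cs.length b) :
    t ∈ cs.invSet (a * b) ↔ t ∈ cs.invSet a ∨ a⁻¹ * t * a ∈ cs.invSet b := by
  rw [mem_invSet_mul]
  have := cs.length_mul_iff.1 h t
  tauto

theorem invSet_subset_iff {a w : W} :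
    cs.invSet a ⊆ cs.invSet w ↔ cs.length w = cs.length a + cs.length (a⁻¹ * w) := by
  have h := cs.length_mul_iff (a := a) (b := a⁻¹ * w)
  rw [mul_inv_cancel_left] at h
  rw [h]
  refine forall₂_congr fun t ht => ?_
  rw [cs.mem_invSet_iff_of_mul a w t]
  tauto

theorem invSet_subset_mul_iff {a b : W} :
    cs.invSet a ⊆ cs.invSet (a * b) ↔ cs.length (a * b) = cs.length a + cs.length b := by
  rw [invSet_subset_iff, inv_mul_cancel_left]

/-- The exchange condition, for words in an arbitrary set of simple reflections. -/
theorem exists_mul_prod_eq_of_mem_invSet {I : Set W} (hI : I ⊆ cs.S) {t : W} (l : List W)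
    (hl : ∀ x ∈ l, x ∈ I) (ht : t ∈ cs.invSet l.prod) :
    ∃ l' : List W, (∀ x ∈ l', x ∈ I) ∧ l'.length + 1 = l.length ∧ t * l.prod = l'.prod := by
  induction l generalizing t with
  | nil => simp at ht
  | cons s l ih =>
    have hs : s ∈ I := hl s (by simp)
    rw [List.prod_cons, mem_invSet_mul, invSet_of_mem_S (hI hs), S_inv (hI hs),
      Set.mem_singleton_iff] at ht
    by_cases h : t = s
    · refine ⟨l, fun x hx => hl x (by simp [hx]), by simp, ?_⟩
      rw [h, List.prod_cons, ← mul_assoc, S_mul_self (hI hs), one_mul]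
    · obtain ⟨l', h1, h2, h3⟩ := ih (t := s * t * s) (fun x hx => hl x (by simp [hx])) (by tauto)
      refine ⟨s :: l', ?_, by simp [h2], ?_⟩
      · simpa [hs] using h1
      · rw [List.prod_cons, List.prod_cons, ← h3, ← mul_assoc, ← mul_assoc, ← mul_assoc,
          ← mul_assoc, S_mul_self (hI hs), one_mul]

theorem exists_list_of_mem_closure {I : Set W} (hI : I ⊆ cs.S) {a : W}
    (ha : a ∈ Subgroup.closure I) : ∃ l : List W, (∀ x ∈ l, x ∈ I) ∧ l.prod = a := by
  induction ha using Subgroup.closure_induction with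
  | mem x hx => exact ⟨[x], by simpa using hx, by simp⟩
  | one => exact ⟨[], by simp, by simp⟩
  | mul x y _ _ hx hy =>
    obtain ⟨l, h1, rfl⟩ := hx
    obtain ⟨l', h2, rfl⟩ := hy
    refine ⟨l ++ l', fun x hx => ?_, by simp⟩
    rcases List.mem_append.1 hx with h | h
    · exact h1 x h
    · exact h2 x h
  | inv x _ hx =>
    obtain ⟨l, h1, rfl⟩ := hx
    refine ⟨(l.map fun x => x⁻¹).reverse, fun x hx => ?_, (List.prod_inv_reverse l).symm⟩
    obtain ⟨y, hy, rfl⟩ := List.mem_map.1 (List.mem_reverse.1 hx)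
    rw [S_inv (hI (h1 y hy))]
    exact h1 y hy

theorem exists_mem_invSet_of_mem_closure {I : Set W} (hI : I ⊆ cs.S) {a : W}
    (ha : a ∈ Subgroup.closure I) (ha1 : a ≠ 1) : ∃ s ∈ I, s ∈ cs.invSet a := by
  classical
  have hex : ∃ n, ∃ l : List W, (∀ x ∈ l, x ∈ I) ∧ l.prod = a ∧ l.length = n := by
    obtain ⟨l, h1, h2⟩ := cs.exists_list_of_mem_closure hI ha
    exact ⟨_, l, h1, h2, rfl⟩
  obtain ⟨l, h1, h2, h3⟩ := Nat.find_spec hex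
  have hmin : ∀ l' : List W, (∀ x ∈ l', x ∈ I) → l'.prod = a → l.length ≤ l'.length := by
    intro l' h h'
    rw [h3]
    exact Nat.find_min' hex ⟨l', h, h', rfl⟩
  cases l with
  | nil => simp at h2; exact absurd h2.symm ha1
  | cons s l =>
    have hs : s ∈ I := h1 s (by simp)
    refine ⟨s, hs, ?_⟩
    by_contra hsa
    rw [← h2, List.prod_cons, mem_invSet_mul, invSet_of_mem_S (hI hs), S_inv (hI hs),
      S_mul_self (hI hs)] at hsa
    simp only [Set.mem_singleton_iff, one_mul, true_iff, not_not] at hsa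
    obtain ⟨l', h4, h5, h6⟩ := cs.exists_mul_prod_eq_of_mem_invSet hI l
      (fun x hx => h1 x (by simp [hx])) hsa
    have := hmin l' h4 (by rw [← h6, ← h2, List.prod_cons])
    simp at this
    omega

theorem invSet_subset_closure {I : Set W} (hI : I ⊆ cs.S) {a : W}
    (ha : a ∈ Subgroup.closure I) : cs.invSet a ⊆ (Subgroup.closure I : Set W) := by
  induction ha using Subgroup.closure_induction with
  | mem x hx =>
    rw [invSet_of_mem_S (hI hx), Set.singleton_subset_iff]
    exact Subgroup.subset_closure hx
  | one => simp
  | mul x y hx hy h1 h2 =>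
    intro t ht
    rcases cs.invSet_mul_subset x y ht with h | ⟨t, h, rfl⟩
    · exact h1 h
    · exact mul_mem (mul_mem hx (h2 h)) (inv_mem hx)
  | inv x hx h =>
    intro t ht
    rw [mem_invSet_inv] at ht
    have := mul_mem (mul_mem (inv_mem hx) (h ht)) hx
    rwa [show x⁻¹ * (x * t * x⁻¹) * x = t by group] at this

theorem mem_of_mem_S_of_mem_closure {I : Set W} (hI : I ⊆ cs.S) {s : W} (hs : s ∈ cs.S)
    (h : s ∈ Subgroup.closure I) : s ∈ I := by
  have h1 : s ≠ 1 := by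
    rintro rfl
    have := invSet_of_mem_S hs
    simp at this
  obtain ⟨s', hs', h'⟩ := cs.exists_mem_invSet_of_mem_closure hI h h1
  rw [invSet_of_mem_S hs] at h'
  rwa [← (h' : s' = s)]

/-- `b` has no left inversion in the parabolic subgroup generated by `I`. -/
def LeftRed (I : Set W) (b : W) : Prop := ∀ t ∈ Subgroup.closure I, t ∉ cs.invSet b

theorem exists_leftRed {I : Set W} (w : W) :
    ∃ a b, a ∈ Subgroup.closure I ∧ cs.LeftRed I b ∧ w = a * b := by
  classical
  have hex : ∃ n, ∃ a ∈ Subgroup.closure I, cs.length (a * w) = n := ⟨_, 1, one_mem _, rfl⟩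
  obtain ⟨a, ha, h⟩ := Nat.find_spec hex
  refine ⟨a⁻¹, a * w, inv_mem ha, ?_, by simp⟩
  intro t ht ht'
  have h1 := ht'.2
  rw [h, ← mul_assoc] at h1
  exact Nat.find_min hex h1 ⟨t * a, mul_mem ht ha, rfl⟩

theorem LeftRed.length_mul {I : Set W} (hI : I ⊆ cs.S) {a b : W} (hb : cs.LeftRed I b)
    (ha : a ∈ Subgroup.closure I) : cs.length (a * b) = cs.length a + cs.length b := by
  rw [length_mul_iff]
  intro t ht
  exact hb _ (mul_mem (mul_mem (inv_mem ha) (cs.invSet_subset_closure hI ha ht)) ha)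

theorem LeftRed.mem_invSet_mul_iff {I : Set W} {a b t : W} (hb : cs.LeftRed I b)
    (ha : a ∈ Subgroup.closure I) (ht : t ∈ Subgroup.closure I) :
    t ∈ cs.invSet (a * b) ↔ t ∈ cs.invSet a := by
  rw [mem_invSet_mul]
  have := hb _ (mul_mem (mul_mem (inv_mem ha) ht) ha)
  tauto

theorem leftRed_iff {I : Set W} (hI : I ⊆ cs.S) {b : W} :
    cs.LeftRed I b ↔ ∀ s ∈ I, s ∉ cs.invSet b := by
  refine ⟨fun h s hs => h s (Subgroup.subset_closure hs), fun h => ?_⟩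
  obtain ⟨a, c, ha, hc, rfl⟩ := cs.exists_leftRed (I := I) b
  by_cases h1 : a = 1
  · simpa [h1] using hc
  · obtain ⟨s, hs, hsa⟩ := cs.exists_mem_invSet_of_mem_closure hI ha h1
    exact absurd ((LeftRed.mem_invSet_mul_iff cs hc ha (Subgroup.subset_closure hs)).2 hsa) (h s hs)

theorem LeftRed.eq {I : Set W} (hI : I ⊆ cs.S) {a b a' b' : W} (hb : cs.LeftRed I b)
    (hb' : cs.LeftRed I b') (ha : a ∈ Subgroup.closure I) (ha' : a' ∈ Subgroup.closure I)
    (h : a * b = a' * b') : a = a' ∧ b = b' := by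
  have : cs.invSet a = cs.invSet a' := by
    ext t
    constructor
    · intro ht
      have h1 := cs.invSet_subset_closure hI ha ht
      rwa [← hb.mem_invSet_mul_iff cs ha h1, h, hb'.mem_invSet_mul_iff cs ha' h1] at ht
    · intro ht
      have h1 := cs.invSet_subset_closure hI ha' ht
      rwa [← hb'.mem_invSet_mul_iff cs ha' h1, ← h, hb.mem_invSet_mul_iff cs ha h1] at ht
  have := cs.invSet_injective this
  subst this
  exact ⟨rfl, mul_left_cancel h⟩

/-- A reflection of a parabolic subgroup which is not too far from preserving a reduced element
is simple. -/
theorem LeftRed.mem_of_length_le {I : Set W} (hI : I ⊆ cs.S) {q b : W} (hb : cs.LeftRed I b)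
    (hq : q ∈ Subgroup.closure I) (hq' : cs.IsReflection q)
    (h : cs.length (q * b) ≤ cs.length b + 1) : q ∈ I := by
  rw [LeftRed.length_mul cs hI hb hq] at h
  have h1 := hq'.odd_length
  have h2 : cs.length q = 1 := by
    obtain ⟨k, hk⟩ := h1
    omega
  obtain ⟨i, rfl⟩ := cs.length_eq_one_iff.1 h2
  exact cs.mem_of_mem_S_of_mem_closure hI ⟨i, rfl⟩ hq

theorem mem_closure_inter {I J : Set W} (hI : I ⊆ cs.S) (hJ : J ⊆ cs.S) {u : W}
    (h1 : u ∈ Subgroup.closure I) (h2 : u ∈ Subgroup.closure J) :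
    u ∈ Subgroup.closure (I ∩ J) := by
  induction hn : cs.length u using Nat.strong_induction_on generalizing u with
  | _ n ih =>
    by_cases hu : u = 1
    · rw [hu]; exact one_mem _
    · obtain ⟨s, hs, hsu⟩ := cs.exists_mem_invSet_of_mem_closure hI h1 hu
      have hsJ := cs.mem_of_mem_S_of_mem_closure hJ (hI hs) (cs.invSet_subset_closure hJ h2 hsu)
      have := ih _ (by rw [← hn]; exact hsu.2)
        (mul_mem (Subgroup.subset_closure hs) h1) (mul_mem (Subgroup.subset_closure hsJ) h2) rfl
      have h4 : s ∈ I ∩ J := ⟨hs, hsJ⟩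
      have h3 := mul_mem (Subgroup.subset_closure h4) this
      rwa [← mul_assoc, S_mul_self (hI hs), one_mul] at h3

/-- Intersection of a parabolic subgroup with its conjugate by a doubly reduced element. -/
theorem mem_closure_inter_conj {K : Set W} (hK : K ⊆ cs.S) {y u : W} (hy : cs.LeftRed K y)
    (hy' : cs.LeftRed K y⁻¹) (hu : u ∈ Subgroup.closure K)
    (hu' : y⁻¹ * u * y ∈ Subgroup.closure K) :
    u ∈ Subgroup.closure ({s | s ∈ K ∧ y⁻¹ * s * y ∈ K} : Set W) := by
  induction hn : cs.length u using Nat.strong_induction_on generalizing u with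
  | _ n ih =>
    by_cases hu1 : u = 1
    · rw [hu1]; exact one_mem _
    obtain ⟨s, hs, hsu⟩ := cs.exists_mem_invSet_of_mem_closure hK hu hu1
    have hsc := Subgroup.subset_closure hs
    obtain ⟨u', hu'def⟩ : ∃ u', u' = y⁻¹ * u * y := ⟨_, rfl⟩
    rw [← hu'def] at hu'
    have e : u * y = y * u' := by rw [hu'def]; group
    have h1 : s ∈ cs.invSet (y * u') := by
      rw [← e, hy.mem_invSet_mul_iff cs hu hsc]
      exact hsu
    rw [mem_invSet_mul] at h1
    have h2 : y⁻¹ * s * y ∈ cs.invSet u' := by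
      have := hy s hsc
      tauto
    have h3 := cs.invSet_subset_closure hK hu' h2
    have h4 : y⁻¹ * s * y ∈ K := by
      have hl := LeftRed.length_mul cs hK hy hsc
      have hl' : cs.length (y⁻¹ * s * y * y⁻¹) = cs.length (s * y) := by
        rw [mul_inv_cancel_right, ← cs.length_inv, mul_inv_rev, inv_inv, S_inv (hK hs)]
      refine hy'.mem_of_length_le cs hK h3 h2.1 ?_
      obtain ⟨i, rfl⟩ := hK hs
      rw [hl', hl, cs.length_inv, cs.length_simple, add_comm]
    have := ih _ (by rw [← hn]; exact hsu.2) (mul_mem hsc hu)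
      (by
        have := mul_mem h3 hu'
        rwa [show y⁻¹ * s * y * u' = y⁻¹ * (s * u) * y by rw [hu'def]; group] at this) rfl
    have h6 : s ∈ {s | s ∈ K ∧ y⁻¹ * s * y ∈ K} := ⟨hs, h4⟩
    have h5 := mul_mem (Subgroup.subset_closure h6) this
    rwa [← mul_assoc, S_mul_self (hK hs), one_mul] at h5

/-- If all elements of `D` are left descents of `w`, so are all elements of the generated
parabolic subgroup. -/
theorem invSet_subset_of_mem_closure {D : Set W} (hD : D ⊆ cs.S) {w : W}
    (h : D ⊆ cs.invSet w) {u : W} (hu : u ∈ Subgroup.closure D) :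
    cs.invSet u ⊆ cs.invSet w := by
  induction hn : cs.length u using Nat.strong_induction_on generalizing u with
  | _ n ih =>
    by_cases hu1 : u = 1
    · simp [hu1]
    obtain ⟨s, hs, hsu⟩ := cs.exists_mem_invSet_of_mem_closure hD hu hu1
    have hss := hD hs
    obtain ⟨v, rfl⟩ : ∃ v, u = s * v := ⟨s⁻¹ * u, by simp⟩
    have hv : v ∈ Subgroup.closure D := (Subgroup.mul_mem_cancel_left _ (Subgroup.subset_closure hs)).1 hu
    have hlt : cs.length v < n := by
      have := hsu.2
      rwa [← mul_assoc, S_mul_self hss, one_mul, hn] at this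
    have h1 := ih _ hlt hv rfl
    have hsv : s ∉ cs.invSet v := by
      rw [mem_invSet_mul, invSet_of_mem_S hss, S_inv hss, S_mul_self hss, one_mul] at hsu
      simpa using hsu
    have h3 : v⁻¹ * s * v ∈ cs.invSet (v⁻¹ * w) := by
      have := (cs.mem_invSet_iff_of_mul v w s).1 (h hs)
      tauto
    rw [invSet_subset_iff] at h1 ⊢
    have h4 := h3.2
    have h5 := cs.length_mul_le s v
    have h6 := cs.length_mul_le (s * v) ((s * v)⁻¹ * w)
    rw [mul_inv_cancel_left] at h6
    have h7 : cs.length s = 1 := by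
      obtain ⟨i, rfl⟩ := hss
      exact cs.length_simple i
    rw [show v⁻¹ * s * v * (v⁻¹ * w) = (s * v)⁻¹ * w by rw [mul_inv_rev, S_inv hss]; group] at h4
    omega

end CoxeterSystem

/-- The conjugate `v⁻¹ J v` of a subset of a group. -/
def conjSet (v : W) (J : Set W) : Set W := {x | v * x * v⁻¹ ∈ J}

theorem mem_conjSet {v x : W} {J : Set W} : x ∈ conjSet v J ↔ v * x * v⁻¹ ∈ J := Iff.rfl

theorem conjSet_mul (v w : W) (J : Set W) : conjSet (v * w) J = conjSet w (conjSet v J) := by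
  ext x
  simp [mem_conjSet, mul_assoc]

@[simp] theorem conjSet_one (J : Set W) : conjSet 1 J = J := by
  ext x
  simp [mem_conjSet]

theorem inv_conj_mem_conjSet {v x : W} {J : Set W} : v⁻¹ * x * v ∈ conjSet v J ↔ x ∈ J := by
  simp [mem_conjSet, mul_assoc]

theorem conjSet_eq_image (v : W) (J : Set W) : conjSet v J = (fun x => v⁻¹ * x * v) '' J := by
  ext x
  constructor
  · intro h
    exact ⟨_, h, by group⟩
  · rintro ⟨y, hy, rfl⟩
    exact inv_conj_mem_conjSet.2 hy

theorem mem_closure_of_mem_closure_conjSet {v x : W} {J : Set W}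
    (h : x ∈ Subgroup.closure (conjSet v J)) : v * x * v⁻¹ ∈ Subgroup.closure J := by
  have : Subgroup.closure (conjSet v J) ≤
      (Subgroup.closure J).comap (MulAut.conj v).toMonoidHom := by
    rw [Subgroup.closure_le]
    intro x hx
    have : v * x * v⁻¹ ∈ Subgroup.closure J := Subgroup.subset_closure (mem_conjSet.1 hx)
    simpa using this
  simpa using this h

theorem mem_closure_conjSet {v x : W} {J : Set W} :
    x ∈ Subgroup.closure (conjSet v J) ↔ v * x * v⁻¹ ∈ Subgroup.closure J := by
  refine ⟨mem_closure_of_mem_closure_conjSet, fun h => ?_⟩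
  have h1 : v * x * v⁻¹ ∈ Subgroup.closure (conjSet v⁻¹ (conjSet v J)) := by
    rwa [← conjSet_mul, mul_inv_cancel, conjSet_one]
  have := mem_closure_of_mem_closure_conjSet h1
  simpa [mul_assoc] using this

theorem inv_conj_mem_closure_conjSet {v x : W} {J : Set W} :
    v⁻¹ * x * v ∈ Subgroup.closure (conjSet v J) ↔ x ∈ Subgroup.closure J := by
  simp [mem_closure_conjSet, mul_assoc]

theorem finite_closure_conjSet {v : W} {J : Set W}
    (h : (Subgroup.closure J : Set W).Finite) :
    (Subgroup.closure (conjSet v J) : Set W).Finite := by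
  refine (h.image fun x => v⁻¹ * x * v).subset fun x hx => ⟨_, mem_closure_conjSet.1 hx, ?_⟩
  group

namespace CoxeterSystem

variable (cs : CoxeterSystem M W)

/-- `v` conjugates the set `J` of simple reflections to a set of simple reflections and no element
of `J` is a left descent of `v`. -/
def Par (J : Set W) (v : W) : Prop := ∀ s ∈ J, v⁻¹ * s * v ∈ cs.S ∧ s ∉ cs.invSet v

variable {cs}

theorem Par.conjSet_subset {J : Set W} {v : W} (h : cs.Par J v) : conjSet v J ⊆ cs.S := by
  rw [conjSet_eq_image]
  rintro _ ⟨s, hs, rfl⟩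
  exact (h s hs).1

theorem Par.leftRed {J : Set W} (hJ : J ⊆ cs.S) {v : W} (h : cs.Par J v) : cs.LeftRed J v :=
  (cs.leftRed_iff hJ).2 fun s hs => (h s hs).2

theorem Par.one {J : Set W} (hJ : J ⊆ cs.S) : cs.Par J 1 := by
  intro s hs
  simpa using hJ hs

theorem Par.mul {J : Set W} {v w : W} (h : cs.Par J v) (h' : cs.Par (conjSet v J) w) :
    cs.Par J (v * w) := by
  intro s hs
  have h1 := h' _ (inv_conj_mem_conjSet.2 hs)
  refine ⟨?_, ?_⟩
  · convert h1.1 using 1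
    group
  · rw [mem_invSet_mul]
    have := (h s hs).2
    tauto

theorem Par.inv {J : Set W} (hJ : J ⊆ cs.S) {v : W} (h : cs.Par J v) :
    cs.Par (conjSet v J) v⁻¹ := by
  intro x hx
  rw [mem_invSet_inv, inv_inv]
  exact ⟨hJ hx, (h _ hx).2⟩

theorem Par.cancel {J : Set W} (hJ : J ⊆ cs.S) {v w : W} (h : cs.Par J (v * w))
    (h' : cs.Par J v) : cs.Par (conjSet v J) w := by
  have h1 : cs.Par (conjSet v⁻¹ (conjSet v J)) (v * w) := by
    rwa [← conjSet_mul, mul_inv_cancel, conjSet_one]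
  simpa using (h'.inv hJ).mul h1

theorem Par.left_factor {J K : Set W} (hK : K ⊆ cs.S) (hJK : J ⊆ K) {a b : W}
    (h : cs.Par J (a * b)) (ha : a ∈ Subgroup.closure K) (hb : cs.LeftRed K b) :
    cs.Par J a ∧ conjSet a J ⊆ K := by
  have key : ∀ s ∈ J, a⁻¹ * s * a ∈ K ∧ s ∉ cs.invSet a := by
    intro s hs
    have hsK := Subgroup.subset_closure (hJK hs)
    obtain ⟨h1, h2⟩ := h s hs
    refine ⟨?_, fun h3 => h2 ((hb.mem_invSet_mul_iff cs ha hsK).2 h3)⟩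
    refine hb.mem_of_length_le cs hK (mul_mem (mul_mem (inv_mem ha) hsK) ha)
      ((cs.isReflection_inv_conj a).2 (.of_mem_S (hK (hJK hs)))) ?_
    rw [show a⁻¹ * s * a * b = b * ((a * b)⁻¹ * s * (a * b)) by group]
    obtain ⟨i, hi⟩ := h1
    rw [← hi]
    rcases cs.length_mul_simple b i with h | h <;> omega
  refine ⟨fun s hs => ⟨hK (key s hs).1, (key s hs).2⟩, ?_⟩
  rw [conjSet_eq_image]
  rintro _ ⟨s, hs, rfl⟩
  exact (key s hs).1

theorem Par.mem_invSet_mul_iff {J : Set W} {h w s : W} (hh : cs.Par J h)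
    (hw : w ∈ Subgroup.closure J) (hs : s ∉ Subgroup.closure J) :
    s ∈ cs.invSet (w * h) ↔ s ∈ cs.invSet h := by
  have h1 : h⁻¹ * w * h ∈ Subgroup.closure (conjSet h J) := inv_conj_mem_closure_conjSet.2 hw
  have h2 : h⁻¹ * s * h ∉ cs.invSet (h⁻¹ * w * h) := fun h3 =>
    hs (inv_conj_mem_closure_conjSet.1 (cs.invSet_subset_closure hh.conjSet_subset h1 h3))
  rw [show w * h = h * (h⁻¹ * w * h) by group, mem_invSet_mul]
  tauto

variable (cs)

/-- `w` is the longest element of the parabolic subgroup generated by `T`. -/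
def IsLongest (T : Set W) (w : W) : Prop :=
  w ∈ Subgroup.closure T ∧
    ∀ t, t ∈ cs.invSet w ↔ cs.IsReflection t ∧ t ∈ Subgroup.closure T

variable {cs}

theorem IsReflection.mem_invSet_self {t : W} (ht : cs.IsReflection t) : t ∈ cs.invSet t := by
  refine ⟨ht, ?_⟩
  rw [ht.mul_self, length_one]
  exact ht.odd_length.pos

theorem IsLongest.of_subset {T : Set W} (hT : T ⊆ cs.S) {w : W} (hw : w ∈ Subgroup.closure T)
    (h : ∀ s ∈ T, s ∈ cs.invSet w) : cs.IsLongest T w :=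
  ⟨hw, fun _ => ⟨fun ht => ⟨ht.1, cs.invSet_subset_closure hT hw ht⟩, fun ht =>
    cs.invSet_subset_of_mem_closure hT h ht.2 ht.1.mem_invSet_self⟩⟩

theorem IsLongest.unique {T : Set W} {w w' : W} (h : cs.IsLongest T w) (h' : cs.IsLongest T w') :
    w = w' := by
  apply cs.invSet_injective
  ext t
  rw [h.2, h'.2]

theorem exists_isLongest {T : Set W} (hT : T ⊆ cs.S)
    (hf : (Subgroup.closure T : Set W).Finite) : ∃ w, cs.IsLongest T w := by
  obtain ⟨w, hw, hmax⟩ := hf.exists_maximalFor cs.length _ ⟨1, one_mem _⟩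
  refine ⟨w, IsLongest.of_subset hT hw fun s hs => ?_⟩
  have hsS := hT hs
  have h1 : s * w ∈ (Subgroup.closure T : Set W) := mul_mem (Subgroup.subset_closure hs) hw
  refine (cs.mem_invSet_iff (.of_mem_S hsS)).2 ?_
  have h2 := (IsReflection.of_mem_S hsS).length_mul_right_ne w
  have h3 := hmax h1
  by_contra h4
  exact h2 (le_antisymm (h3 (by omega)) (by omega))

theorem finite_closure_of_subset_invSet {D : Set W} (hD : D ⊆ cs.S) {w : W}
    (h : D ⊆ cs.invSet w) : (Subgroup.closure D : Set W).Finite := by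
  refine Set.Finite.of_finite_image (f := cs.invSet) ?_ cs.invSet_injective.injOn
  refine (cs.finite_invSet w).powerset.subset ?_
  rintro _ ⟨u, hu, rfl⟩
  exact cs.invSet_subset_of_mem_closure hD h hu

/-- The basic step: if `h` conjugates `J` to simple reflections, and `s ∉ J` is a left descent of
`h`, then `J ∪ {s}` is spherical. -/
theorem Par.step {J : Set W} (hJ : J ⊆ cs.S) {h wJ s : W} (hh : cs.Par J h)
    (hwJ : cs.IsLongest J wJ) (hs : s ∈ cs.S) (hsJ : s ∉ J) (hsh : s ∈ cs.invSet h) :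
    insert s J ⊆ cs.invSet (wJ * h) ∧ (Subgroup.closure (insert s J) : Set W).Finite := by
  have h1 : insert s J ⊆ cs.invSet (wJ * h) := by
    rintro x (rfl | hx)
    · exact (hh.mem_invSet_mul_iff hwJ.1
        fun hc => hsJ (cs.mem_of_mem_S_of_mem_closure hJ hs hc)).2 hsh
    · have := (cs.mem_invSet_mul_of_length ((hh.leftRed hJ).length_mul cs hJ hwJ.1) (t := x)).2
      refine this (Or.inl ((hwJ.2 x).2 ⟨.of_mem_S (hJ hx), Subgroup.subset_closure hx⟩))
  exact ⟨h1, finite_closure_of_subset_invSet (Set.insert_subset hs hJ) h1⟩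

theorem Par.step_isLongest {J : Set W} (hJ : J ⊆ cs.S) {a b wJ s : W} (hh : cs.Par J (a * b))
    (hwJ : cs.IsLongest J wJ) (hs : s ∈ cs.S) (hsJ : s ∉ J) (hsh : s ∈ cs.invSet (a * b))
    (ha : a ∈ Subgroup.closure (insert s J)) (hb : cs.LeftRed (insert s J) b) :
    cs.IsLongest (insert s J) (wJ * a) := by
  have hm : wJ * a ∈ Subgroup.closure (insert s J) :=
    mul_mem (Subgroup.closure_mono (Set.subset_insert s J) hwJ.1) ha
  refine IsLongest.of_subset (Set.insert_subset hs hJ) hm fun x hx => ?_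
  rw [← hb.mem_invSet_mul_iff cs hm (Subgroup.subset_closure hx), mul_assoc]
  exact (hh.step hJ hwJ hs hsJ hsh).1 hx

theorem Par.mem_invSet_of_step {J : Set W} (hJ : J ⊆ cs.S) {h wJ s t : W} (hh : cs.Par J h)
    (hwJ : cs.IsLongest J wJ) (hs : s ∈ cs.S) (hsJ : s ∉ J) (hsh : s ∈ cs.invSet h)
    (ht : cs.IsReflection t) (ht1 : t ∈ Subgroup.closure (insert s J))
    (ht2 : t ∉ Subgroup.closure J) : t ∈ cs.invSet h := by
  rw [← hh.mem_invSet_mul_iff hwJ.1 ht2]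
  exact cs.invSet_subset_of_mem_closure (Set.insert_subset hs hJ)
    (hh.step hJ hwJ hs hsJ hsh).1 ht1 ht.mem_invSet_self

end CoxeterSystem

theorem Set.Finite.image_of_factors {α β γ : Type*} {D : Set α} {f : α → β} {θ : α → γ}
    (hf : (f '' D).Finite) (h : ∀ x ∈ D, ∀ y ∈ D, f x = f y → θ x = θ y) : (θ '' D).Finite := by
  classical
  rcases D.eq_empty_or_nonempty with rfl | ⟨x0, hx0⟩
  · simp
  refine (hf.image fun b => if hb : ∃ x ∈ D, f x = b then θ hb.choose else θ x0).subset ?_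
  rintro _ ⟨x, hx, rfl⟩
  refine ⟨f x, ⟨x, hx, rfl⟩, ?_⟩
  have hb : ∃ y ∈ D, f y = f x := ⟨x, hx, rfl⟩
  simp only [hb, dif_pos]
  exact h _ hb.choose_spec.1 _ hx hb.choose_spec.2

namespace CoxeterSystem

variable {cs : CoxeterSystem M W}

theorem eq_one_of_forall_not_mem_invSet {I : Set W} (hI : I ⊆ cs.S) {y : W}
    (hy : y ∈ Subgroup.closure I) (h : ∀ r ∈ I, r ∉ cs.invSet y) : y = 1 := by
  by_contra h1
  obtain ⟨s, hs, hsy⟩ := cs.exists_mem_invSet_of_mem_closure hI hy h1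
  exact h s hs hsy

theorem finite_of_conj_mem_aux {B₀ : Set W} (hB : B₀ ⊆ cs.S) (hBf : B₀.Finite) (n : ℕ) :
    ∀ (J : Set W) (G Ω : Set W), J ⊆ B₀ → (B₀ \ J).ncard = n → Ω.Finite →
    G ⊆ (Subgroup.closure B₀ : Set W) →
    (∀ h ∈ G, ∀ r ∈ B₀, r ∈ cs.invSet h → h⁻¹ * r * h ∈ Ω) →
    (∀ g ∈ G, ∀ h ∈ G, ∀ r ∈ J, g⁻¹ * r * g = h⁻¹ * r * h ∧ (r ∈ cs.invSet g ↔ r ∈ cs.invSet h)) →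
    G.Finite := by
  classical
  induction n using Nat.strong_induction_on with
  | _ n ih =>
    intro J G Ω hJ hn hΩ hGB hG hconst
    rcases G.eq_empty_or_nonempty with rfl | ⟨h₁, hh₁⟩
    · exact Set.finite_empty
    obtain ⟨Ω', hΩ'def⟩ : ∃ Ω', Ω' = (fun x => h₁ * x * h₁⁻¹) '' Ω ∪ cs.invSet h₁ := ⟨_, rfl⟩
    have hΩ'f : Ω'.Finite := by
      rw [hΩ'def]
      exact (hΩ.image _).union (cs.finite_invSet _)
    have hΩ' : ∀ h ∈ G, ∀ r ∈ B₀, r ∈ cs.invSet (h * h₁⁻¹) →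
        (h * h₁⁻¹)⁻¹ * r * (h * h₁⁻¹) ∈ Ω' := by
      intro h hh r hr hrm
      rw [hΩ'def]
      rcases cs.invSet_mul_subset _ _ hrm with h2 | ⟨t, h2, h3⟩
      · refine Or.inl ⟨_, hG h hh r hr h2, ?_⟩
        group
      · rw [mem_invSet_inv] at h2
        refine Or.inr ?_
        convert h2 using 1
        rw [← h3]
        group
    have : Finite B₀ := hBf
    let F : W → (B₀ → Option W) := fun h r =>
      if (r : W) ∈ cs.invSet (h * h₁⁻¹) then some ((h * h₁⁻¹)⁻¹ * r * (h * h₁⁻¹)) else none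
    refine Set.Finite.of_finite_fibers F ?_ ?_
    · refine (Set.Finite.pi' (t := fun _ : B₀ => insert none (some '' Ω'))
        fun _ => (hΩ'f.image _).insert _).subset ?_
      rintro _ ⟨h, hh, rfl⟩ r
      by_cases hr : (r : W) ∈ cs.invSet (h * h₁⁻¹)
      · simp only [F, hr, if_true]
        exact Or.inr ⟨_, hΩ' h hh r r.2 hr, rfl⟩
      · simp only [F, hr, if_false]
        exact Or.inl rfl
    · rintro _ ⟨h₂, hh₂, rfl⟩
      obtain ⟨D, hD⟩ : ∃ D, D = {r | r ∈ B₀ ∧ r ∈ cs.invSet (h₂ * h₁⁻¹)} := ⟨_, rfl⟩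
      have hfib : ∀ h ∈ G ∩ F ⁻¹' {F h₂}, ∀ r ∈ B₀,
          (r ∈ cs.invSet (h * h₁⁻¹) ↔ r ∈ D) ∧ (r ∈ D → (h * h₁⁻¹)⁻¹ * r * (h * h₁⁻¹) =
            (h₂ * h₁⁻¹)⁻¹ * r * (h₂ * h₁⁻¹)) := by
        rintro h ⟨-, hh⟩ r hr
        have h3 : F h ⟨r, hr⟩ = F h₂ ⟨r, hr⟩ := congrFun hh _
        have h4 : r ∈ D ↔ r ∈ cs.invSet (h₂ * h₁⁻¹) := by simp [hD, hr]
        rw [h4]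
        simp only [F] at h3
        by_cases h5 : r ∈ cs.invSet (h * h₁⁻¹) <;> by_cases h6 : r ∈ cs.invSet (h₂ * h₁⁻¹) <;>
          simp only [h5, h6, if_true, if_false, reduceCtorEq, Option.some.injEq] at h3 ⊢
        · exact ⟨trivial, fun _ => h3⟩
        · simp
      have hmem : ∀ h ∈ G, h * h₁⁻¹ ∈ (Subgroup.closure B₀ : Set W) := fun h hh =>
        mul_mem (hGB hh) (inv_mem (hGB hh₁))
      rcases D.eq_empty_or_nonempty with hDe | ⟨d, hd⟩
      · refine (Set.finite_singleton h₁).subset ?_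
        intro h hh
        have := eq_one_of_forall_not_mem_invSet hB (hmem h hh.1) fun r hr => by
          rw [(hfib h hh r hr).1, hDe]
          exact Set.notMem_empty r
        exact mul_inv_eq_one.1 this
      · have hJD : ∀ r ∈ J, ∀ h ∈ G, r ∉ cs.invSet (h * h₁⁻¹) := by
          intro r hr h hh
          have h3 := hconst h hh h₁ hh₁ r hr
          rw [mem_invSet_mul, mem_invSet_inv, h3.1, h3.2]
          rw [show h₁ * (h₁⁻¹ * r * h₁) * h₁⁻¹ = r by group]
          simp
        have hdB : d ∈ B₀ := by rw [hD] at hd; exact hd.1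
        have hdJ : d ∉ J := fun h3 => hJD d h3 h₂ hh₂ (by rw [hD] at hd; exact hd.2)
        have hDB : D ⊆ B₀ := by rw [hD]; exact fun r hr => hr.1
        have hfin := ih (B₀ \ (J ∪ D)).ncard ?_ (J ∪ D)
          ((fun h => h * h₁⁻¹) '' (G ∩ F ⁻¹' {F h₂})) Ω' (Set.union_subset hJ hDB) rfl hΩ'f
          ?_ ?_ ?_
        · exact Set.Finite.of_finite_image hfin (mul_left_injective _).injOn
        · rw [← hn]
          refine Set.ncard_lt_ncard ?_ (hBf.subset Set.sdiff_subset)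
          refine ⟨fun x hx => ⟨hx.1, fun h3 => hx.2 (Or.inl h3)⟩, fun h3 => ?_⟩
          exact (h3 ⟨hdB, hdJ⟩).2 (Or.inr hd)
        · rintro _ ⟨h, hh, rfl⟩
          exact hmem h hh.1
        · rintro _ ⟨h, hh, rfl⟩ r hr
          exact hΩ' h hh.1 r hr
        · rintro _ ⟨g, hg, rfl⟩ _ ⟨h, hh, rfl⟩ r (hr | hr)
          · refine ⟨?_, iff_of_false (hJD r hr g hg.1) (hJD r hr h hh.1)⟩
            have h3 := (hconst g hg.1 h₁ hh₁ r hr).1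
            have h4 := (hconst h hh.1 h₁ hh₁ r hr).1
            calc (g * h₁⁻¹)⁻¹ * r * (g * h₁⁻¹) = h₁ * (g⁻¹ * r * g) * h₁⁻¹ := by group
              _ = h₁ * (h⁻¹ * r * h) * h₁⁻¹ := by rw [h3, h4]
              _ = (h * h₁⁻¹)⁻¹ * r * (h * h₁⁻¹) := by group
          · have h3 := hfib g hg r (hDB hr)
            have h4 := hfib h hh r (hDB hr)
            exact ⟨by rw [h3.2 hr, h4.2 hr], by rw [h3.1, h4.1]⟩

/-- A set of elements of a finitely generated parabolic subgroup, each of which conjugates its left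
descents into a fixed finite set, is finite. -/
theorem finite_of_conj_mem {B₀ : Set W} (hB : B₀ ⊆ cs.S) (hBf : B₀.Finite) {G Ω : Set W}
    (hΩ : Ω.Finite) (hGB : G ⊆ (Subgroup.closure B₀ : Set W))
    (hG : ∀ h ∈ G, ∀ r ∈ B₀, r ∈ cs.invSet h → h⁻¹ * r * h ∈ Ω) : G.Finite :=
  finite_of_conj_mem_aux hB hBf _ ∅ G Ω (Set.empty_subset _) rfl hΩ hGB hG (by simp)

end CoxeterSystem

namespace CoxeterSystem

variable (cs : CoxeterSystem M W)

/-- The elements `v` that are minimal for the weak order among those which conjugate `J` to simple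
reflections, have no left descent in `J`, and have `t` as a left inversion. -/
def minPar (J : Set W) (t : W) : Set W :=
  {v | cs.Par J v ∧ t ∈ cs.invSet v ∧
    ∀ v', cs.Par J v' → t ∈ cs.invSet v' → cs.invSet v' ⊆ cs.invSet v → v' = v}

variable {cs}

theorem exists_mem_minPar {J : Set W} {t w : W} (hw : cs.Par J w) (ht : t ∈ cs.invSet w) :
    ∃ v ∈ cs.minPar J t, cs.invSet v ⊆ cs.invSet w := by
  obtain ⟨n, hn⟩ : ∃ n, cs.length w = n := ⟨_, rfl⟩
  induction n using Nat.strong_induction_on generalizing w with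
  | _ n ih =>
    by_cases h : ∀ v', cs.Par J v' → t ∈ cs.invSet v' → cs.invSet v' ⊆ cs.invSet w → v' = w
    · exact ⟨w, ⟨hw, ht, h⟩, subset_rfl⟩
    · push Not at h
      obtain ⟨v', h1, h2, h3, h4⟩ := h
      have h5 : cs.length v' < cs.length w := by
        rw [← cs.ncard_invSet v', ← cs.ncard_invSet w]
        refine Set.ncard_lt_ncard (h3.ssubset_of_ne fun h6 => h4 (cs.invSet_injective h6))
          (cs.finite_invSet w)
      obtain ⟨v, hv, hvv⟩ := ih _ (hn ▸ h5) h1 h2 rfl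
      exact ⟨v, hv, hvv.trans h3⟩

theorem mem_closure_of_mem_minPar {J B₀ : Set W} {t v : W} (hB : B₀ ⊆ cs.S) (hJB : J ⊆ B₀)
    (ht : t ∈ Subgroup.closure B₀) (hv : v ∈ cs.minPar J t) : v ∈ Subgroup.closure B₀ := by
  obtain ⟨a, b, ha, hb, rfl⟩ := cs.exists_leftRed (I := B₀) v
  obtain ⟨h1, h2, h3⟩ := hv
  have h4 := h3 a (h1.left_factor hB hJB ha hb).1 ((hb.mem_invSet_mul_iff cs ha ht).1 h2)
    (cs.invSet_subset_mul_iff.2 (hb.length_mul cs hB ha))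
  rwa [← h4]

/-- Factorisation of a minimal element along one of its right descents. -/
theorem exists_factor_of_mem_minPar {J₀ : Set W} (hJ₀ : J₀ ⊆ cs.S) {t v s : W}
    (hv : v ∈ cs.minPar J₀ t) (hs : s ∈ cs.S) (hsv : s ∈ cs.invSet v⁻¹) :
    ∃ g c, v = g * c ∧ c ∈ Subgroup.closure (insert s (conjSet v J₀)) ∧
      cs.LeftRed (insert s (conjSet v J₀)) g⁻¹ ∧ cs.Par J₀ g ∧
      conjSet g J₀ ⊆ insert s (conjSet v J₀) ∧ t ∉ cs.invSet g ∧
      g⁻¹ * t * g ∈ Subgroup.closure (insert s (conjSet v J₀)) := by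
  obtain ⟨J, hJ⟩ : ∃ J, J = conjSet v J₀ := ⟨_, rfl⟩
  rw [← hJ]
  have hJS : J ⊆ cs.S := hJ ▸ hv.1.conjSet_subset
  have hK : insert s J ⊆ cs.S := Set.insert_subset hs hJS
  have hP : cs.Par J v⁻¹ := hJ ▸ hv.1.inv hJ₀
  obtain ⟨a, b, ha, hb, hab⟩ := cs.exists_leftRed (I := insert s J) v⁻¹
  have hve : v = b⁻¹ * a⁻¹ := by rw [← mul_inv_rev, ← hab, inv_inv]
  rw [hab] at hP hsv
  obtain ⟨h1, h2⟩ := hP.left_factor hK (Set.subset_insert s J) ha hb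
  have h3 := hP.cancel hJS h1
  have h4 := h3.inv h1.conjSet_subset
  have h5 : conjSet b (conjSet a J) = J₀ := by
    rw [← conjSet_mul, ← hab, hJ, ← conjSet_mul, mul_inv_cancel, conjSet_one]
  have h6 : conjSet b⁻¹ J₀ = conjSet a J := by
    rw [← h5, ← conjSet_mul b, mul_inv_cancel, conjSet_one]
  rw [h5] at h4
  have h7 : cs.invSet b⁻¹ ⊆ cs.invSet v := by
    rw [hve, cs.invSet_subset_mul_iff, ← mul_inv_rev, cs.length_inv, cs.length_inv, cs.length_inv,
      hb.length_mul cs hK ha, add_comm]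
  have h8 : t ∉ cs.invSet b⁻¹ := fun h9 => by
    have h10 := hv.2.2 _ h4 h9 h7
    have h11 : a = 1 := by
      rw [hve] at h10
      simpa using h10
    rw [hb.mem_invSet_mul_iff cs ha (Subgroup.subset_closure (Set.mem_insert s J)), h11] at hsv
    simp at hsv
  have h9 := hv.2.1
  rw [hve, mem_invSet_mul] at h9
  have h10 : b⁻¹⁻¹ * t * b⁻¹ ∈ cs.invSet a⁻¹ := by tauto
  exact ⟨b⁻¹, a⁻¹, hve, inv_mem ha, by rwa [inv_inv], h4, h6 ▸ h2, h8,
    cs.invSet_subset_closure hK (inv_mem ha) h10⟩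

variable (cs) in
/-- The data extracted from a minimal element `v = g * c` with `c ∈ ⟨K⟩`. -/
structure IsCorner (B₀ J₀ : Set W) (t : W) (K : Set W) (k g : W) : Prop where
  subset : K ⊆ B₀
  mem : g ∈ Subgroup.closure B₀
  isLongest : cs.IsLongest K k
  finite : (Subgroup.closure K : Set W).Finite
  par : cs.Par J₀ g
  leftRed : cs.LeftRed K g⁻¹
  conj_mem : g⁻¹ * t * g ∈ Subgroup.closure K
  not_mem_closure : t ∉ Subgroup.closure J₀
  not_mem : t ∉ cs.invSet g
  exists_insert : ∃ κ, K = insert κ (conjSet g J₀) ∧ κ ∉ conjSet g J₀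
  mem_invSet : ∀ r ∈ cs.S, r ∈ cs.invSet g⁻¹ → g * r * g⁻¹ ∈ cs.invSet (g * k * g⁻¹)

theorem ncard_conjSet (v : W) (J : Set W) : (conjSet v J).ncard = J.ncard := by
  rw [conjSet_eq_image]
  exact Set.ncard_image_of_injective _ fun x y h => by simpa using h

theorem exists_isCorner {B₀ J₀ : Set W} (hB : B₀ ⊆ cs.S) (hJB : J₀ ⊆ B₀)
    (hJf : (Subgroup.closure J₀ : Set W).Finite) {t v : W}
    (ht : t ∈ Subgroup.closure B₀) (hv : v ∈ cs.minPar J₀ t) :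
    ∃ K k g, cs.IsCorner B₀ J₀ t K k g ∧ ∃ c ∈ Subgroup.closure K, v = g * c := by
  have hJ₀ := hJB.trans hB
  have hvB := mem_closure_of_mem_minPar hB hJB ht hv
  have hv1 : v⁻¹ ≠ 1 := by
    intro h
    rw [inv_eq_one] at h
    have := hv.2.1
    simp [h] at this
  obtain ⟨s, hsB, hsv⟩ := cs.exists_mem_invSet_of_mem_closure hB (inv_mem hvB) hv1
  have hs := hB hsB
  obtain ⟨g, c, hgc, hc, hred, hg, hgK, htg, htK⟩ := exists_factor_of_mem_minPar hJ₀ hv hs hsv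
  have huniq : ∀ s' ∈ cs.S, s' ∈ cs.invSet v⁻¹ → s' = s := by
    intro s' hs' hsv'
    by_contra hne
    obtain ⟨g', c', hgc', hc', -, -, -, -, htK'⟩ := exists_factor_of_mem_minPar hJ₀ hv hs' hsv'
    have h1 : v⁻¹ * t * v ∈ Subgroup.closure (insert s (conjSet v J₀)) := by
      rw [hgc, show (g * c)⁻¹ * t * (g * c) = c⁻¹ * (g⁻¹ * t * g) * c by group, ← hgc]
      exact mul_mem (mul_mem (inv_mem hc) htK) hc
    have h2 : v⁻¹ * t * v ∈ Subgroup.closure (insert s' (conjSet v J₀)) := by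
      rw [hgc', show (g' * c')⁻¹ * t * (g' * c') = c'⁻¹ * (g'⁻¹ * t * g') * c' by group, ← hgc']
      exact mul_mem (mul_mem (inv_mem hc') htK') hc'
    have hJS := hv.1.conjSet_subset
    have h3 := cs.mem_closure_inter (Set.insert_subset hs hJS) (Set.insert_subset hs' hJS) h1 h2
    have h4 : v⁻¹ * t * v ∈ Subgroup.closure (conjSet v J₀) := by
      refine Subgroup.closure_mono ?_ h3
      rintro x ⟨h5 | h5, h6 | h6⟩
      · exact absurd (h6.symm.trans h5) hne
      · exact h6
      · exact h5
      · exact h5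
    exact hv.1.leftRed hJ₀ t (inv_conj_mem_closure_conjSet.1 h4) hv.2.1
  obtain ⟨J, hJ⟩ : ∃ J, J = conjSet v J₀ := ⟨_, rfl⟩
  rw [← hJ] at hc hred hgK htK
  have hJS : J ⊆ cs.S := hJ ▸ hv.1.conjSet_subset
  have hP : cs.Par J v⁻¹ := hJ ▸ hv.1.inv hJ₀
  have hsJ : s ∉ J := fun h => (hP s h).2 hsv
  have hJfin : (Subgroup.closure J : Set W).Finite := hJ ▸ finite_closure_conjSet hJf
  have hv' : v⁻¹ = c⁻¹ * g⁻¹ := by rw [hgc, mul_inv_rev]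
  obtain ⟨wJ, hwJ⟩ := exists_isLongest hJS hJfin
  have hKB : insert s J ⊆ B₀ := by
    refine Set.insert_subset hsB fun x hx => ?_
    refine cs.mem_of_mem_S_of_mem_closure hB (hJS hx) ?_
    rw [show x = v⁻¹ * (v * x * v⁻¹) * v by group]
    have h1 : v * x * v⁻¹ ∈ J₀ := by rwa [hJ] at hx
    exact mul_mem (mul_mem (inv_mem hvB) (Subgroup.subset_closure (hJB h1))) hvB
  have hgB : g ∈ Subgroup.closure B₀ := by
    rw [show g = v * c⁻¹ by rw [hgc]; group]
    exact mul_mem hvB (inv_mem (Subgroup.closure_mono hKB hc))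
  refine ⟨insert s J, wJ * c⁻¹, g, ⟨hKB, hgB, ?_, (hP.step hJS hwJ hs hsJ hsv).2, hg, hred, htK,
    fun h => hv.1.leftRed hJ₀ t h hv.2.1, htg, ?_, ?_⟩, c, hc, hgc⟩
  · rw [hv'] at hP hsv
    exact hP.step_isLongest hJS hwJ hs hsJ hsv (inv_mem hc) hred
  · have hfJ : J₀.Finite := hJf.subset Subgroup.subset_closure
    have hfJ' : J.Finite := hJfin.subset Subgroup.subset_closure
    have h1 : (insert s J \ conjSet g J₀).ncard = 1 := by
      rw [Set.ncard_sdiff hgK ((hfJ'.insert s).subset hgK), ncard_conjSet,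
        Set.ncard_insert_of_notMem hsJ hfJ', hJ, ncard_conjSet]
      omega
    obtain ⟨κ, hκ⟩ := Set.ncard_eq_one.1 h1
    have h2 : κ ∈ insert s J \ conjSet g J₀ := by rw [hκ]; rfl
    refine ⟨κ, ?_, h2.2⟩
    rw [← Set.singleton_union (s := conjSet g J₀), ← hκ, Set.sdiff_union_of_subset hgK]
  · intro r hr hrg
    have h1 : r ∉ Subgroup.closure (insert s J) := fun h => hred r h hrg
    have h2 : r ∉ cs.invSet v⁻¹ := fun h =>
      h1 (Subgroup.subset_closure (huniq r hr h ▸ Set.mem_insert _ _))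
    have h3 : r ∉ cs.invSet (wJ * v⁻¹) := by
      rwa [hP.mem_invSet_mul_iff hwJ.1
        fun h => h1 (Subgroup.closure_mono (Set.subset_insert s J) h)]
    rw [show g * (wJ * c⁻¹) * g⁻¹ = g * (wJ * v⁻¹) by rw [hv']; group, mem_invSet_mul]
    have h4 := cs.mem_invSet_inv.1 hrg
    rw [show g⁻¹ * (g * r * g⁻¹) * g = r by group]
    tauto

theorem IsCorner.leftRed_mul {B₀ J₀ : Set W} (hJf : (Subgroup.closure J₀ : Set W).Finite) {t : W} (hB : B₀ ⊆ cs.S)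
    (htr : cs.IsReflection t) {K : Set W} {k g₁ g₂ : W}
    (h₁ : cs.IsCorner B₀ J₀ t K k g₁) (h₂ : cs.IsCorner B₀ J₀ t K k g₂) :
    cs.LeftRed K (g₁⁻¹ * g₂) := by
  obtain ⟨κ, hκ, hκ'⟩ := h₁.exists_insert
  have hK : K ⊆ cs.S := h₁.subset.trans hB
  have hJ' : conjSet g₁ J₀ ⊆ cs.S := h₁.par.conjSet_subset
  have hP : cs.Par (conjSet g₁ J₀) (g₁⁻¹ * g₂) := by
    rw [conjSet_eq_image]
    rintro _ ⟨s, hs, rfl⟩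
    refine ⟨?_, ?_⟩
    · rw [show (g₁⁻¹ * g₂)⁻¹ * (g₁⁻¹ * s * g₁) * (g₁⁻¹ * g₂) = g₂⁻¹ * s * g₂ by group]
      exact (h₂.par s hs).1
    · have h3 : g₁⁻¹ * s * g₁ ∈ K := by
        rw [hκ]
        exact Or.inr (inv_conj_mem_conjSet.2 hs)
      have h4 := h₁.leftRed _ (Subgroup.subset_closure h3)
      have h5 := (h₂.par s hs).2
      rw [mem_invSet_mul, inv_inv, show g₁ * (g₁⁻¹ * s * g₁) * g₁⁻¹ = s by group]
      tauto
  have ht0 : g₁⁻¹ * t * g₁ ∉ cs.invSet (g₁⁻¹ * g₂) := by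
    have h4 := h₁.leftRed _ h₁.conj_mem
    have h5 := h₂.not_mem
    rw [mem_invSet_mul, inv_inv, show g₁ * (g₁⁻¹ * t * g₁) * g₁⁻¹ = t by group]
    tauto
  obtain ⟨wJ, hwJ⟩ := exists_isLongest hJ' (finite_closure_conjSet hJf)
  refine (cs.leftRed_iff hK).2 fun s hs => ?_
  have hs' := hs
  rw [hκ] at hs'
  rcases hs' with rfl | hs'
  · intro h3
    refine ht0 (hP.mem_invSet_of_step hJ' hwJ (hK hs) hκ' h3
      ((cs.isReflection_inv_conj g₁).2 htr) (hκ ▸ h₁.conj_mem) ?_)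
    exact fun h4 => h₁.not_mem_closure (inv_conj_mem_closure_conjSet.1 h4)
  · exact (hP s hs').2

theorem IsCorner.conj_eq {B₀ J₀ : Set W} (hJf : (Subgroup.closure J₀ : Set W).Finite) {t : W} (hB : B₀ ⊆ cs.S)
    (htr : cs.IsReflection t) {K : Set W} {k g₁ g₂ : W}
    (h₁ : cs.IsCorner B₀ J₀ t K k g₁) (h₂ : cs.IsCorner B₀ J₀ t K k g₂)
    (ht : g₁⁻¹ * t * g₁ = g₂⁻¹ * t * g₂)
    (hJ : ∀ s ∈ J₀, g₁⁻¹ * s * g₁ = g₂⁻¹ * s * g₂) : g₁ * k * g₁⁻¹ = g₂ * k * g₂⁻¹ := by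
  have hy := h₁.leftRed_mul hJf hB htr h₂
  have hy' := h₂.leftRed_mul hJf hB htr h₁
  obtain ⟨y, hyd⟩ : ∃ y, y = g₁⁻¹ * g₂ := ⟨_, rfl⟩
  rw [← hyd] at hy
  rw [show g₂⁻¹ * g₁ = y⁻¹ by rw [hyd]; group] at hy'
  have hg₂ : g₂ = g₁ * y := by rw [hyd]; group
  have hK : K ⊆ cs.S := h₁.subset.trans hB
  obtain ⟨κ, hκ, hκ'⟩ := h₁.exists_insert
  have hJ' : ∀ x ∈ conjSet g₁ J₀, y⁻¹ * x * y = x := by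
    rw [conjSet_eq_image]
    rintro _ ⟨s, hs, rfl⟩
    have := hJ s hs
    rw [hg₂] at this
    simp only
    nth_rewrite 2 [this]
    group
  have ht' : y⁻¹ * (g₁⁻¹ * t * g₁) * y = g₁⁻¹ * t * g₁ := by
    rw [hg₂] at ht
    nth_rewrite 2 [ht]
    group
  have h3 := cs.mem_closure_inter_conj hK hy hy' h₁.conj_mem (ht'.symm ▸ h₁.conj_mem)
  have hκK : κ ∈ K := hκ ▸ Set.mem_insert _ _
  have h4 : y⁻¹ * κ * y ∈ K := by
    by_contra h5
    have h6 : g₁⁻¹ * t * g₁ ∈ Subgroup.closure (conjSet g₁ J₀) := by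
      refine Subgroup.closure_mono ?_ h3
      rintro x ⟨h7, h8⟩
      rw [hκ] at h7
      rcases h7 with rfl | h7
      · exact absurd h8 h5
      · exact h7
    exact h₁.not_mem_closure (inv_conj_mem_closure_conjSet.1 h6)
  have h5 : y⁻¹ * κ * y = κ := by
    rw [hκ] at h4
    rcases h4 with h6 | h6
    · exact h6
    · have h7 := hJ' _ h6
      have h8 : y⁻¹ * κ * y = κ := by
        have h9 := congrArg (fun z => y * z * y⁻¹) h7
        simpa [mul_assoc] using h9
      exact h8
  have h6 : Subgroup.closure K ≤ Subgroup.centralizer {y} := by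
    rw [Subgroup.closure_le]
    intro x hx
    have h7 : y⁻¹ * x * y = x := by
      rw [hκ] at hx
      rcases hx with rfl | hx
      · exact h5
      · exact hJ' x hx
    rw [SetLike.mem_coe, Subgroup.mem_centralizer_singleton_iff]
    have h8 := congrArg (fun z => y * z) h7
    simpa [mul_assoc] using h8
  have h7 := h6 h₁.isLongest.1
  rw [Subgroup.mem_centralizer_singleton_iff] at h7
  rw [hg₂, mul_assoc g₁ y k, ← h7]
  group

theorem finite_isCorner {B₀ J₀ : Set W} (hB : B₀ ⊆ cs.S) (hBf : B₀.Finite) (hJB : J₀ ⊆ B₀)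
    (hJf : (Subgroup.closure J₀ : Set W).Finite) {t : W} (htr : cs.IsReflection t) (K : Set W) :
    {g | ∃ k, cs.IsCorner B₀ J₀ t K k g}.Finite := by
  rcases Set.eq_empty_or_nonempty {g | ∃ k, cs.IsCorner B₀ J₀ t K k g} with h | ⟨g₀, k, hk⟩
  · rw [h]
    exact Set.finite_empty
  obtain ⟨D, hD⟩ : ∃ D, D = {g | ∃ k, cs.IsCorner B₀ J₀ t K k g} := ⟨_, rfl⟩
  rw [← hD]
  have hDk : ∀ g ∈ D, cs.IsCorner B₀ J₀ t K k g := by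
    rw [hD]
    rintro g ⟨k', hk'⟩
    rwa [hk.isLongest.unique hk'.isLongest]
  have hJ₀f : Finite J₀ := hBf.subset hJB
  have hθ : ((fun g => g * k * g⁻¹) '' D).Finite := by
    refine Set.Finite.image_of_factors
      (f := fun g => (g⁻¹ * t * g, fun j : J₀ => g⁻¹ * (j : W) * g)) ?_ ?_
    · refine (hk.finite.prod (Set.Finite.pi' (t := fun _ : J₀ => B₀) fun _ => hBf)).subset ?_
      rintro _ ⟨g, hg, rfl⟩
      refine ⟨(hDk g hg).conj_mem, fun j => ?_⟩
      obtain ⟨κ, hκ, -⟩ := (hDk g hg).exists_insert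
      refine (hDk g hg).subset ?_
      rw [hκ]
      exact Or.inr (inv_conj_mem_conjSet.2 j.2)
    · intro g₁ h₁ g₂ h₂ h
      simp only [Prod.mk.injEq] at h
      exact (hDk _ h₁).conj_eq hJf hB htr (hDk _ h₂) h.1 fun s hs => congrFun h.2 ⟨s, hs⟩
  have h1 : ((fun g => g⁻¹) '' D).Finite := by
    refine finite_of_conj_mem hB hBf
      (hθ.biUnion fun θ _ => cs.finite_invSet θ) ?_ ?_
    · rintro _ ⟨g, hg, rfl⟩
      exact inv_mem (hDk g hg).mem
    · rintro _ ⟨g, hg, rfl⟩ r hr hrg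
      refine Set.mem_biUnion ⟨g, hg, rfl⟩ ?_
      rw [inv_inv]
      exact (hDk g hg).mem_invSet r (hB hr) hrg
  exact Set.Finite.of_finite_image h1 inv_injective.injOn

theorem exists_finset_mem_closure (w : W) :
    ∃ B₀ : Set W, B₀ ⊆ cs.S ∧ B₀.Finite ∧ w ∈ Subgroup.closure B₀ := by
  obtain ⟨ω, rfl⟩ := cs.wordProd_surjective w
  refine ⟨{x | x ∈ ω.map cs.simple}, ?_, List.finite_toSet _, ?_⟩
  · intro x hx
    obtain ⟨i, -, rfl⟩ := List.mem_map.1 hx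
    exact ⟨i, rfl⟩
  · exact Subgroup.list_prod_mem _ fun x hx => Subgroup.subset_closure hx

/-- There are only finitely many minimal elements. -/
theorem finite_minPar {J₀ : Set W} (hJ₀ : J₀ ⊆ cs.S)
    (hJf : (Subgroup.closure J₀ : Set W).Finite) {t : W} (htr : cs.IsReflection t) :
    (cs.minPar J₀ t).Finite := by
  obtain ⟨B₁, hB₁, hB₁f, ht₁⟩ := exists_finset_mem_closure (cs := cs) t
  obtain ⟨B₀, hB₀⟩ : ∃ B₀, B₀ = B₁ ∪ J₀ := ⟨_, rfl⟩
  have hB : B₀ ⊆ cs.S := hB₀ ▸ Set.union_subset hB₁ hJ₀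
  have hBf : B₀.Finite := hB₀ ▸ hB₁f.union (hJf.subset Subgroup.subset_closure)
  have hJB : J₀ ⊆ B₀ := hB₀ ▸ Set.subset_union_right
  have ht : t ∈ Subgroup.closure B₀ :=
    Subgroup.closure_mono (hB₀ ▸ Set.subset_union_left) ht₁
  have hfin := hBf.powerset.biUnion (t := fun K => Set.image2 (fun g c => g * c)
    {g | ∃ k, cs.IsCorner B₀ J₀ t K k g} (Subgroup.closure K : Set W)) ?_
  · refine hfin.subset fun v hv => ?_
    obtain ⟨K, k, g, hg, c, hc, rfl⟩ := exists_isCorner hB hJB hJf ht hv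
    exact Set.mem_biUnion hg.subset ⟨g, ⟨k, hg⟩, c, hc, rfl⟩
  · intro K _
    rcases Set.eq_empty_or_nonempty {g | ∃ k, cs.IsCorner B₀ J₀ t K k g} with h | ⟨g₀, k, hk⟩
    · simp [h]
    · exact (finite_isCorner hB hBf hJB hJf htr K).image2 _ hk.finite

end CoxeterSystem

namespace CoxeterSystem

variable {cs : CoxeterSystem M W}

theorem LeftRed.of_mul {I : Set W} {b q : W} (h : cs.LeftRed I (b * q))
    (hl : cs.length (b * q) = cs.length b + cs.length q) : cs.LeftRed I b :=
  fun t ht ht' => h t ht (cs.invSet_subset_mul_iff.2 hl ht')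

theorem LeftRed.mono {I J : Set W} (hIJ : I ⊆ J) {b : W} (h : cs.LeftRed J b) :
    cs.LeftRed I b := fun t ht => h t (Subgroup.closure_mono hIJ ht)

theorem LeftRed.inv_conj_mem {I J : Set W} (hI : I ⊆ cs.S) (hJ : J ⊆ cs.S) {b s : W}
    (hb' : cs.LeftRed J b⁻¹) (hs : s ∈ I) (h : b⁻¹ * s * b ∈ Subgroup.closure J) :
    b⁻¹ * s * b ∈ J := by
  refine hb'.mem_of_length_le cs hJ h ((cs.isReflection_inv_conj b).2 (.of_mem_S (hI hs))) ?_
  rw [show b⁻¹ * s * b * b⁻¹ = b⁻¹ * s by group]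
  obtain ⟨i, hi⟩ := hI hs
  rw [← hi]
  rcases cs.length_mul_simple b⁻¹ i with h | h <;> omega

/-- The left `I`-part of an element `b * q` with `q ∈ ⟨J⟩`, where `b` is reduced with respect to
`I` and `J`. -/
theorem LeftRed.exists_mul_eq {I J : Set W} (hI : I ⊆ cs.S) (hJ : J ⊆ cs.S) {b q : W}
    (hb : cs.LeftRed I b) (hb' : cs.LeftRed J b⁻¹) (hq : q ∈ Subgroup.closure J) :
    ∃ u ∈ Subgroup.closure ({s | s ∈ I ∧ b⁻¹ * s * b ∈ J} : Set W), ∃ e, cs.LeftRed I e ∧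
      b * q = u * e := by
  obtain ⟨l, hl, rfl⟩ := cs.exists_list_of_mem_closure hJ hq
  clear hq
  induction l using List.reverseRecOn with
  | nil => exact ⟨1, one_mem _, b, hb, by simp⟩
  | append_singleton l s ih =>
    obtain ⟨u, hu, e, he, hue⟩ := ih fun x hx => hl x (by simp [hx])
    have hs : s ∈ J := hl s (by simp)
    have heq : b * (l ++ [s]).prod = u * (e * s) := by
      rw [List.prod_append, ← mul_assoc, hue]
      simp [mul_assoc]
    by_cases h : cs.LeftRed I (e * s)
    · exact ⟨u, hu, e * s, h, heq⟩
    · rw [cs.leftRed_iff hI] at h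
      push Not at h
      obtain ⟨s', hs', h1⟩ := h
      have h2 := he s' (Subgroup.subset_closure hs')
      rw [mem_invSet_mul, invSet_of_mem_S (hJ hs), Set.mem_singleton_iff] at h1
      have h3 : e⁻¹ * s' * e = s := by tauto
      have h4 : s' * e = e * s := by rw [← h3]; group
      have h5 : ∀ u ∈ Subgroup.closure ({s | s ∈ I ∧ b⁻¹ * s * b ∈ J} : Set W),
          b⁻¹ * u * b ∈ Subgroup.closure J := by
        intro u hu
        have h6 : Subgroup.closure ({s | s ∈ I ∧ b⁻¹ * s * b ∈ J} : Set W) ≤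
            Subgroup.closure (conjSet b⁻¹ J) := Subgroup.closure_mono fun x hx => by
          simpa [mem_conjSet] using hx.2
        simpa using mem_closure_conjSet.1 (h6 hu)
      have hs'J : b⁻¹ * s' * b ∈ J := by
        refine hb'.inv_conj_mem hI hJ hs' ?_
        have h6 : s' = e * s * e⁻¹ := by rw [← h4]; group
        have h7 : e = u⁻¹ * (b * l.prod) := by rw [hue]; group
        rw [show b⁻¹ * s' * b = (b⁻¹ * u⁻¹ * b) * l.prod * s *
          ((b⁻¹ * u⁻¹ * b) * l.prod)⁻¹ by rw [h6, h7]; group]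
        have h8 : b⁻¹ * u⁻¹ * b * l.prod ∈ Subgroup.closure J :=
          mul_mem (h5 _ (inv_mem hu)) (Subgroup.list_prod_mem _ fun x hx =>
            Subgroup.subset_closure (hl x (by simp [hx])))
        exact mul_mem (mul_mem h8 (Subgroup.subset_closure hs)) (inv_mem h8)
      have hs'm : s' ∈ ({s | s ∈ I ∧ b⁻¹ * s * b ∈ J} : Set W) := ⟨hs', hs'J⟩
      exact ⟨u * s', mul_mem hu (Subgroup.subset_closure hs'm), e, he, by
        rw [heq, ← h4, mul_assoc]⟩

theorem exists_image_simple {I : Set W} (hI : I ⊆ cs.S) : ∃ I' : Set B, cs.simple '' I' = I :=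
  ⟨cs.simple ⁻¹' I, Set.image_preimage_eq_of_subset hI⟩

theorem image_simple_subset (I : Set B) : cs.simple '' I ⊆ cs.S := Set.image_subset_range _ _

end CoxeterSystem

namespace Bldg

variable {cs : CoxeterSystem M W} (X : Bldg cs)

@[simp] theorem delta_self (C : X.Chamber) : X.delta C C = 1 := (X.delta_eq_one_iff C C).2 rfl

theorem delta_symm_simple {C D : X.Chamber} {i : B} (h : X.delta C D = cs.simple i) :
    X.delta D C = cs.simple i := by
  rcases X.delta_mem_pair D C D i h with h1 | h1
  · rw [delta_self] at h1
    rw [← cs.inv_simple i]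
    exact eq_inv_of_mul_eq_one_left h1.symm
  · rw [delta_self] at h1
    have h2 := (X.delta_eq_one_iff D C).1 h1.symm
    rw [h2, delta_self] at h
    have := cs.length_simple i
    simp [← h] at this

theorem exists_right_descent {w : W} (hw : w ≠ 1) :
    ∃ i, cs.length (w * cs.simple i) + 1 = cs.length w := by
  obtain ⟨i, hi⟩ := cs.exists_rightDescent_of_ne_one hw
  exact ⟨i, cs.isRightDescent_iff.1 hi⟩

theorem delta_add {C D E : X.Chamber}
    (h : cs.length (X.delta C D * X.delta D E) =
      cs.length (X.delta C D) + cs.length (X.delta D E)) :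
    X.delta C E = X.delta C D * X.delta D E := by
  obtain ⟨n, hn⟩ : ∃ n, cs.length (X.delta D E) = n := ⟨_, rfl⟩
  induction n generalizing E with
  | zero =>
    rw [cs.length_eq_zero_iff] at hn
    rw [hn, mul_one, (X.delta_eq_one_iff D E).1 hn]
  | succ n ih =>
    have h1 : X.delta D E ≠ 1 := fun h2 => by simp [h2] at hn
    obtain ⟨i, hi⟩ := exists_right_descent h1
    obtain ⟨F, hF, hDF⟩ := X.exists_delta D E i
    have h2 := cs.length_mul_le (X.delta C D) (X.delta D F)
    have h3 := cs.length_mul_le (X.delta C D * X.delta D F) (cs.simple i)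
    have h4 : X.delta C D * X.delta D E = X.delta C D * X.delta D F * cs.simple i := by
      simp [hDF, mul_assoc]
    rw [← h4, cs.length_simple] at h3
    rw [← hDF] at hi
    have h5 := ih (E := F) (by omega) (by omega)
    rw [h4, ← h5]
    refine X.delta_eq_of_length C F E i (X.delta_symm_simple hF) ?_
    rw [h5, ← h4]
    omega

theorem delta_symm (C D : X.Chamber) : X.delta D C = (X.delta C D)⁻¹ := by
  obtain ⟨n, hn⟩ : ∃ n, cs.length (X.delta C D) = n := ⟨_, rfl⟩
  induction n generalizing D with
  | zero =>
    rw [cs.length_eq_zero_iff] at hn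
    rw [(X.delta_eq_one_iff C D).1 hn]
    simp
  | succ n ih =>
    have h1 : X.delta C D ≠ 1 := fun h2 => by simp [h2] at hn
    obtain ⟨i, hi⟩ := exists_right_descent h1
    obtain ⟨F, hF, hCF⟩ := X.exists_delta C D i
    rw [← hCF] at hi
    have h2 := ih F (by omega)
    have h3 : X.delta D F * X.delta F C = (X.delta C D)⁻¹ := by
      rw [h2, hF, hCF]
      simp
    rw [← h3]
    refine X.delta_add ?_
    rw [h3, cs.length_inv, hF, cs.length_simple, h2, cs.length_inv]
    omega

theorem exists_delta_eq_mul {I : Set W} (hI : I ⊆ cs.S) {C D E : X.Chamber}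
    (h : X.delta D E ∈ Subgroup.closure I) :
    ∃ u ∈ Subgroup.closure I, X.delta C E = X.delta C D * u := by
  obtain ⟨n, hn⟩ : ∃ n, cs.length (X.delta D E) = n := ⟨_, rfl⟩
  induction n generalizing E with
  | zero =>
    rw [cs.length_eq_zero_iff] at hn
    exact ⟨1, one_mem _, by rw [mul_one, (X.delta_eq_one_iff D E).1 hn]⟩
  | succ n ih =>
    have h1 : (X.delta D E)⁻¹ ≠ 1 := fun h2 => by
      rw [inv_eq_one] at h2
      simp [h2] at hn
    obtain ⟨s, hs, hsm⟩ := cs.exists_mem_invSet_of_mem_closure hI (inv_mem h) h1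
    obtain ⟨i, rfl⟩ := hI hs
    obtain ⟨F, hF, hDF⟩ := X.exists_delta D E i
    have h2 := (cs.mem_invSet_iff (cs.isReflection_simple i)).1 hsm
    have h3 : cs.simple i * (X.delta D E)⁻¹ = (X.delta D F)⁻¹ := by rw [hDF]; simp
    rw [h3, cs.length_inv, cs.length_inv] at h2
    have h5 := cs.length_mul_le (X.delta D F) (cs.simple i)
    rw [cs.length_simple, show X.delta D F * cs.simple i = X.delta D E by rw [hDF]; simp] at h5
    have hs' := Subgroup.subset_closure hs
    obtain ⟨u, hu, hu'⟩ := ih (E := F) (hDF ▸ mul_mem h hs') (by omega)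
    rcases X.delta_mem_pair C F E i (X.delta_symm_simple hF) with h4 | h4
    · exact ⟨u * cs.simple i, mul_mem hu hs', by rw [h4, hu', mul_assoc]⟩
    · exact ⟨u, hu, by rw [h4, hu']⟩

/-- The residue of a chamber, for a set of elements of `W`. -/
def res (I : Set W) (C : X.Chamber) : Set X.Chamber := {D | X.delta C D ∈ Subgroup.closure I}

theorem mem_res {I : Set W} {C D : X.Chamber} :
    D ∈ X.res I C ↔ X.delta C D ∈ Subgroup.closure I := Iff.rfl

theorem mem_res_self (I : Set W) (C : X.Chamber) : C ∈ X.res I C := by simp [mem_res]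

theorem mem_res_symm {I : Set W} {C D : X.Chamber} (h : D ∈ X.res I C) : C ∈ X.res I D := by
  rw [mem_res, delta_symm]
  exact inv_mem h

theorem res_eq_of_mem {I : Set W} (hI : I ⊆ cs.S) {C D : X.Chamber} (h : D ∈ X.res I C) :
    X.res I D = X.res I C := by
  have key : ∀ C D, D ∈ X.res I C → X.res I D ⊆ X.res I C := by
    intro C D h E hE
    obtain ⟨u, hu, hu'⟩ := X.exists_delta_eq_mul hI (C := C) hE
    rw [mem_res, hu']
    exact mul_mem h hu
  exact (key _ _ h).antisymm (key _ _ (X.mem_res_symm h))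

theorem exists_mem_res_delta_eq {I : Set W} (hI : I ⊆ cs.S) (C D : X.Chamber) {u : W}
    (hu : u ∈ Subgroup.closure I) : ∃ E ∈ X.res I D, X.delta C E = X.delta C D * u := by
  obtain ⟨l, hl, rfl⟩ := cs.exists_list_of_mem_closure hI hu
  clear hu
  induction l generalizing D with
  | nil => exact ⟨D, X.mem_res_self I D, by simp⟩
  | cons s l ih =>
    have hs : s ∈ I := hl s (by simp)
    obtain ⟨i, hi⟩ := hI hs
    obtain ⟨F, hF, hCF⟩ := X.exists_delta C D i
    obtain ⟨E, hE, hCE⟩ := ih F fun x hx => hl x (by simp [hx])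
    have h1 : F ∈ X.res I D := by
      rw [mem_res, hF, hi]
      exact Subgroup.subset_closure hs
    refine ⟨E, X.res_eq_of_mem hI h1 ▸ hE, ?_⟩
    rw [hCE, hCF, hi]
    simp [mul_assoc]

theorem delta_of_leftRed {I : Set W} (hI : I ⊆ cs.S) {C D E : X.Chamber}
    (h : cs.LeftRed I (X.delta C D)⁻¹) (hE : E ∈ X.res I D) :
    X.delta C E = X.delta C D * X.delta D E ∧ cs.length (X.delta C D * X.delta D E) =
      cs.length (X.delta C D) + cs.length (X.delta D E) := by
  have h1 := h.length_mul cs hI (inv_mem hE)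
  rw [← mul_inv_rev, cs.length_inv, cs.length_inv, cs.length_inv, add_comm] at h1
  exact ⟨X.delta_add h1, h1⟩

theorem gate_spec {I : Set W} (hI : I ⊆ cs.S) (C D : X.Chamber) :
    X.gate (X.res I D) C ∈ X.res I D ∧
      cs.LeftRed I (X.delta C (X.gate (X.res I D) C))⁻¹ := by
  obtain ⟨a, b, ha, hb, hab⟩ := cs.exists_leftRed (I := I) (X.delta C D)⁻¹
  obtain ⟨E, hE, hCE⟩ := X.exists_mem_res_delta_eq hI C D ha
  have h1 : (X.delta C E)⁻¹ = b := by
    rw [hCE, mul_inv_rev, hab]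
    group
  rw [← h1] at hb
  have h2 : ∀ F ∈ X.res I D, X.gdist C F = X.gdist C E + X.gdist E F := by
    intro F hF
    rw [← X.res_eq_of_mem hI hE] at hF
    have h3 := X.delta_of_leftRed hI hb hF
    unfold gdist
    rw [h3.1, h3.2]
  have h3 := Classical.epsilon_spec (p := fun D' => D' ∈ X.res I D ∧ ∀ F ∈ X.res I D,
    X.gdist C F = X.gdist C D' + X.gdist D' F) ⟨E, hE, h2⟩
  change X.gate (X.res I D) C ∈ X.res I D ∧ _ at h3
  have h4 : X.gdist E (X.gate (X.res I D) C) = 0 := by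
    have h5 := h2 _ h3.1
    have h6 := h3.2 _ hE
    change X.gdist C E = X.gdist C (X.gate (X.res I D) C) + _ at h6
    omega
  have h5 : E = X.gate (X.res I D) C :=
    (X.delta_eq_one_iff _ _).1 (cs.length_eq_zero_iff.1 h4)
  rw [← h5]
  exact ⟨hE, hb⟩

theorem gate_eq {I : Set W} (hI : I ⊆ cs.S) {C D E : X.Chamber} (hE : E ∈ X.res I D)
    (h : cs.LeftRed I (X.delta C E)⁻¹) : X.gate (X.res I D) C = E := by
  obtain ⟨h1, h2⟩ := X.gate_spec hI C D
  have h3 := X.delta_of_leftRed hI h ((X.res_eq_of_mem hI hE).symm.subset h1)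
  have h4 := X.delta_of_leftRed hI h2 ((X.res_eq_of_mem hI h1).symm.subset hE)
  rw [← h3.1] at h3
  rw [← h4.1] at h4
  refine ((X.delta_eq_one_iff _ _).1 (cs.length_eq_zero_iff.1 ?_)).symm
  omega

end Bldg

/-- The elements of `I` conjugated into `J` by `b`. -/
def conjInter (I : Set W) (b : W) (J : Set W) : Set W := {s | s ∈ I ∧ b⁻¹ * s * b ∈ J}

theorem conjInter_subset (I : Set W) (b : W) (J : Set W) : conjInter I b J ⊆ I := fun _ h => h.1

theorem inv_conj_mem_of_mem_closure_conjInter {I J : Set W} {b u : W}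
    (hu : u ∈ Subgroup.closure (conjInter I b J)) : b⁻¹ * u * b ∈ Subgroup.closure J := by
  have h6 : Subgroup.closure (conjInter I b J) ≤ Subgroup.closure (conjSet b⁻¹ J) :=
    Subgroup.closure_mono fun x hx => by simpa [mem_conjSet] using hx.2
  simpa using mem_closure_conjSet.1 (h6 hu)

namespace Bldg

variable {cs : CoxeterSystem M W} (X : Bldg cs)

theorem gate_gate {I J : Set W} (hI : I ⊆ cs.S) (hJ : J ⊆ cs.S) {y₀ r₀ y r z : X.Chamber}
    (hy : y ∈ X.res I y₀) (hr : X.gate (X.res J r₀) y = r) (hz : X.gate (X.res I y₀) r = z) :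
    X.gate (X.res J r₀) z = r ∧ X.delta y r = X.delta y z * X.delta z r ∧
      X.delta y z ∈ Subgroup.closure I ∧ cs.LeftRed I (X.delta z r) ∧
      cs.LeftRed J (X.delta z r)⁻¹ := by
  have h1 := X.gate_spec hI r y₀
  have h2 := X.gate_spec hJ y r₀
  rw [hz, ← X.delta_symm r z] at h1
  rw [hr] at h2
  have hzy : y ∈ X.res I z := by rwa [X.res_eq_of_mem hI h1.1]
  have h4 : X.delta y r = X.delta y z * X.delta z r := by
    refine X.delta_add (h1.2.length_mul cs hI ?_)
    exact X.mem_res_symm hzy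
  have h3 : X.delta y z ∈ Subgroup.closure I := X.mem_res_symm hzy
  have h5 : cs.LeftRed J (X.delta z r)⁻¹ := by
    have h6 := h2.2
    rw [h4, mul_inv_rev] at h6
    refine h6.of_mul ?_
    rw [← mul_inv_rev, cs.length_inv, cs.length_inv, cs.length_inv, h1.2.length_mul cs hI h3,
      add_comm]
  exact ⟨X.gate_eq hJ h2.1 h5, h4, h3, h1.2, h5⟩

theorem projSet_eq {I J : Set W} (hI : I ⊆ cs.S) (hJ : J ⊆ cs.S) {y₀ r₀ z r : X.Chamber}
    (hz : z ∈ X.res I y₀) (hr : r ∈ X.res J r₀) (hb : cs.LeftRed I (X.delta z r))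
    (hb' : cs.LeftRed J (X.delta z r)⁻¹) :
    X.projSet (X.res I y₀) (X.res J r₀) = X.res (conjInter I (X.delta z r) J) z := by
  have hL : conjInter I (X.delta z r) J ⊆ cs.S := (conjInter_subset _ _ _).trans hI
  ext E
  constructor
  · rintro ⟨F, hF, rfl⟩
    have h1 := X.gate_spec hI F y₀
    rw [← X.res_eq_of_mem hJ hr] at hF
    rw [← X.res_eq_of_mem hI hz] at h1 ⊢
    obtain ⟨E, hE⟩ : ∃ E, E = X.gate (X.res I z) F := ⟨_, rfl⟩
    rw [← hE] at h1 ⊢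
    have h2 := (X.delta_of_leftRed hJ hb' hF).1
    have h3 : cs.LeftRed I (X.delta E F) := by
      rw [← X.delta_symm F E] at h1
      exact h1.2
    have h4 : X.delta z F = X.delta z E * X.delta E F :=
      X.delta_add (h3.length_mul cs hI h1.1)
    obtain ⟨u, hu, e, he, h5⟩ := hb.exists_mul_eq hI hJ hb' hF
    rw [← h2, h4] at h5
    have h6 := (h3.eq cs hI he h1.1 (Subgroup.closure_mono (conjInter_subset _ _ _) hu) h5).1
    rw [mem_res, h6]
    exact hu
  · intro hE
    have h1 := inv_conj_mem_of_mem_closure_conjInter hE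
    have h2 : X.delta E r = (X.delta z E)⁻¹ * X.delta z r := by
      have hEI := Subgroup.closure_mono (conjInter_subset _ _ _) hE
      rw [← X.delta_symm]
      refine X.delta_add (hb.length_mul cs hI ?_)
      rw [X.delta_symm]
      exact inv_mem hEI
    obtain ⟨F, hF, hEF⟩ := X.exists_mem_res_delta_eq hJ E r h1
    refine ⟨F, X.res_eq_of_mem hJ hr ▸ hF, X.gate_eq hI ?_ ?_⟩
    · rw [← X.res_eq_of_mem hI hz]
      exact Subgroup.closure_mono (conjInter_subset _ _ _) hE
    · rw [← X.delta_symm, hEF, h2]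
      convert hb using 1
      group

theorem exists_type (R : X.Res) : ∃ I : Set W, I ⊆ cs.S ∧
    (Subgroup.closure I : Set W).Finite ∧ ∃ C, R.1 = X.res I C := by
  obtain ⟨I, C, hI, h⟩ := R.2
  exact ⟨_, cs.image_simple_subset I, hI, C, h⟩

/-- A type of a spherical residue, as a set of simple reflections. -/
def typ (R : X.Res) : Set W := (X.exists_type R).choose

theorem typ_subset (R : X.Res) : X.typ R ⊆ cs.S := (X.exists_type R).choose_spec.1

theorem typ_finite (R : X.Res) : (Subgroup.closure (X.typ R) : Set W).Finite :=
  (X.exists_type R).choose_spec.2.1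

theorem exists_eq_res (R : X.Res) : ∃ C, R.1 = X.res (X.typ R) C :=
  (X.exists_type R).choose_spec.2.2

theorem eq_res_of_mem (R : X.Res) {C : X.Chamber} (hC : C ∈ R.1) : R.1 = X.res (X.typ R) C := by
  obtain ⟨D, hD⟩ := X.exists_eq_res R
  rw [hD] at hC ⊢
  exact (X.res_eq_of_mem (X.typ_subset R) hC).symm

theorem nonempty_res (R : X.Res) : R.1.Nonempty := by
  obtain ⟨D, hD⟩ := X.exists_eq_res R
  exact ⟨D, hD ▸ X.mem_res_self _ D⟩

theorem isSphResidue_res {I : Set W} (hI : I ⊆ cs.S) (hf : (Subgroup.closure I : Set W).Finite)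
    (C : X.Chamber) : X.IsSphResidue (X.res I C) := by
  obtain ⟨I', rfl⟩ := CoxeterSystem.exists_image_simple hI
  exact ⟨I', C, hf, rfl⟩

theorem subset_of_res_subset {I J : Set W} (hI : I ⊆ cs.S) (hJ : J ⊆ cs.S) {C : X.Chamber}
    (h : X.res I C ⊆ X.res J C) : I ⊆ J := by
  intro s hs
  obtain ⟨i, hi⟩ := hI hs
  obtain ⟨E, hE, -⟩ := X.exists_delta C C i
  have h1 : E ∈ X.res I C := by
    rw [mem_res, hE, hi]
    exact Subgroup.subset_closure hs
  have h2 := h h1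
  rw [mem_res, hE, hi] at h2
  exact cs.mem_of_mem_S_of_mem_closure hJ (hI hs) h2

theorem typ_eq {R : X.Res} {I : Set W} (hI : I ⊆ cs.S) {C : X.Chamber} (h : R.1 = X.res I C) :
    X.typ R = I := by
  have h1 := X.eq_res_of_mem R (h ▸ X.mem_res_self I C)
  rw [h] at h1
  exact (X.subset_of_res_subset (X.typ_subset R) hI h1.symm.subset).antisymm
    (X.subset_of_res_subset hI (X.typ_subset R) h1.subset)

/-- The Weyl distance from a chamber to its gate in a spherical residue. -/
def toGate (R : X.Res) (y : X.Chamber) : W := X.delta y (X.gate R.1 y)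

theorem gate_mem (R : X.Res) (y : X.Chamber) : X.gate R.1 y ∈ R.1 := by
  obtain ⟨D, hD⟩ := X.exists_eq_res R
  rw [hD]
  exact (X.gate_spec (X.typ_subset R) y D).1

theorem leftRed_toGate_inv (R : X.Res) (y : X.Chamber) :
    cs.LeftRed (X.typ R) (X.toGate R y)⁻¹ := by
  obtain ⟨D, hD⟩ := X.exists_eq_res R
  unfold toGate
  rw [hD]
  exact (X.gate_spec (X.typ_subset R) y D).2

/-- A chamber `y` of `R` lying in the projection of `T` to `R`, and the decomposition of the
distance from a chamber of `R` to `T`. -/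
theorem exists_proj (R T : X.Res) {y : X.Chamber} (hy : y ∈ R.1) :
    ∃ z, z ∈ R.1 ∧ X.gate T.1 z = X.gate T.1 y ∧
      X.toGate T y = X.delta y z * X.toGate T z ∧ X.delta y z ∈ Subgroup.closure (X.typ R) ∧
      cs.LeftRed (X.typ R) (X.toGate T z) ∧
      X.projSet R.1 T.1 = X.res (conjInter (X.typ R) (X.toGate T z) (X.typ T)) z := by
  have hR := X.eq_res_of_mem R hy
  obtain ⟨r₀, hT⟩ := X.exists_eq_res T
  have hI := X.typ_subset R
  have hJ := X.typ_subset T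
  have h1 := X.gate_gate hI hJ (X.mem_res_self _ y) (r₀ := r₀) rfl rfl
  have h0 := (X.gate_spec hI (X.gate (X.res (X.typ T) r₀) y) y).1
  have h0' := (X.gate_spec hJ y r₀).1
  refine ⟨X.gate (X.res (X.typ R) y) (X.gate (X.res (X.typ T) r₀) y), ?_, ?_⟩
  · rwa [hR]
  · unfold toGate
    rw [← hT] at h1 ⊢
    rw [h1.1]
    refine ⟨rfl, h1.2.1, h1.2.2.1, h1.2.2.2.1, ?_⟩
    rw [hR]
    nth_rewrite 1 [hT]
    rw [hT] at h1
    rw [hT]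
    exact X.projSet_eq hI hJ h0 h0' h1.2.2.2.1 h1.2.2.2.2

theorem projRes_val (R T : X.Res) : (X.projRes R T).1 = X.projSet R.1 T.1 := by
  obtain ⟨y, hy⟩ := X.nonempty_res R
  obtain ⟨z, -, -, -, -, -, h⟩ := X.exists_proj R T hy
  have h1 : X.IsSphResidue (X.projSet R.1 T.1) := by
    rw [h]
    exact X.isSphResidue_res ((conjInter_subset _ _ _).trans (X.typ_subset R))
      ((X.typ_finite R).subset (Subgroup.closure_mono (conjInter_subset _ _ _))) z
  exact Classical.epsilon_spec (p := fun U : X.Res => U.1 = X.projSet R.1 T.1) ⟨⟨_, h1⟩, rfl⟩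

/-- The residue `R` equals its projection from `T`, seen from a chamber `y` of `R`. -/
theorem projRes_eq_self_iff (R T : X.Res) {y : X.Chamber} (hy : y ∈ R.1) :
    X.projRes R T = R ↔ cs.LeftRed (X.typ R) (X.toGate T y) ∧
      ∀ s ∈ X.typ R, (X.toGate T y)⁻¹ * s * X.toGate T y ∈ X.typ T := by
  have hR := X.eq_res_of_mem R hy
  obtain ⟨r₀, hT⟩ := X.exists_eq_res T
  have hI := X.typ_subset R
  have hJ := X.typ_subset T
  have h0' := (X.gate_spec hJ y r₀).1
  have key (hb : cs.LeftRed (X.typ R) (X.toGate T y)) : X.projSet R.1 T.1 =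
      X.res (conjInter (X.typ R) (X.toGate T y) (X.typ T)) y := by
    have h1 := X.leftRed_toGate_inv T y
    unfold toGate at hb h1 ⊢
    rw [hT] at hb h1 ⊢
    rw [hR]
    exact X.projSet_eq hI hJ (X.mem_res_self _ y) h0' hb h1
  constructor
  · intro h
    have h1 : y ∈ X.projSet R.1 T.1 := by rw [← projRes_val, h]; exact hy
    obtain ⟨F, hF, hFy⟩ := h1
    rw [hT] at hF
    rw [hR] at hFy
    have h2 := X.gate_gate hJ hI hF hFy rfl
    have h3 : cs.LeftRed (X.typ R) (X.toGate T y) := by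
      have h4 := h2.2.2.2.2
      rw [← X.delta_symm, ← hT] at h4
      exact h4
    refine ⟨h3, fun s hs => ?_⟩
    have h4 := key h3
    rw [← projRes_val, h, hR] at h4
    exact (X.subset_of_res_subset hI ((conjInter_subset _ _ _).trans hI) h4.subset hs).2
  · rintro ⟨h1, h2⟩
    refine Subtype.ext ?_
    rw [projRes_val, key h1, hR]
    congr 1
    exact (conjInter_subset _ _ _).antisymm fun s hs => ⟨hs, h2 s hs⟩

/-- The projection `U` of `T` on `R`, seen from a chamber `y` of `R`. -/
theorem projRes_spec (R T : X.Res) {y : X.Chamber} (hy : y ∈ R.1) :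
    ∃ z, z = X.gate (X.projRes R T).1 y ∧ z ∈ (X.projRes R T).1 ∧ X.gate T.1 z = X.gate T.1 y ∧
      X.toGate T y = X.delta y z * X.toGate T z ∧ X.delta y z ∈ Subgroup.closure (X.typ R) ∧
      cs.LeftRed (X.typ R) (X.toGate T z) ∧
      X.typ (X.projRes R T) = conjInter (X.typ R) (X.toGate T z) (X.typ T) ∧
      cs.LeftRed (X.typ (X.projRes R T)) (X.delta y z)⁻¹ ∧
      X.projRes (X.projRes R T) T = X.projRes R T := by
  obtain ⟨z, hz, hg, hw, ha, hb, hp⟩ := X.exists_proj R T hy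
  obtain ⟨L, hL⟩ : ∃ L, L = conjInter (X.typ R) (X.toGate T z) (X.typ T) := ⟨_, rfl⟩
  have hLI : L ⊆ X.typ R := hL ▸ conjInter_subset _ _ _
  have hLS : L ⊆ cs.S := hLI.trans (X.typ_subset R)
  rw [← hL, ← projRes_val] at hp
  have hzU : z ∈ (X.projRes R T).1 := hp ▸ X.mem_res_self L z
  have htyp : X.typ (X.projRes R T) = L := X.typ_eq hLS hp
  have hred : cs.LeftRed L (X.delta y z)⁻¹ := by
    rw [cs.leftRed_iff hLS]
    intro s hs hsa
    have hs' : (X.toGate T z)⁻¹ * s * X.toGate T z ∈ X.typ T := by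
      rw [hL] at hs
      exact hs.2
    have h1 := X.leftRed_toGate_inv T y _ (Subgroup.subset_closure hs')
    have h2 := X.leftRed_toGate_inv T z _ (Subgroup.subset_closure hs')
    rw [hw, mul_inv_rev, cs.mem_invSet_mul, inv_inv,
      show ∀ b : W, b * (b⁻¹ * s * b) * b⁻¹ = s from fun b => by group] at h1
    tauto
  refine ⟨z, ?_, hzU, hg, hw, ha, hb, htyp.trans hL, htyp ▸ hred, ?_⟩
  · rw [hp]
    exact (X.gate_eq hLS (X.mem_res_self L z) hred).symm
  · rw [X.projRes_eq_self_iff _ T hzU, htyp]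
    refine ⟨hb.mono hLI, fun s hs => ?_⟩
    rw [hL] at hs
    exact hs.2

end Bldg

namespace Bldg

variable {cs : CoxeterSystem M W} (X : Bldg cs)

theorem mem_convHull {𝓡 : Set X.Res} {U : X.Res} (h : U ∈ 𝓡) : U ∈ X.convHull 𝓡 :=
  fun _ hS => hS.2 h

theorem convexResSet_convHull (𝓡 : Set X.Res) : X.ConvexResSet (X.convHull 𝓡) :=
  ⟨fun R₁ R₂ h h₂ S hS => hS.1.1 R₁ R₂ h (h₂ S hS),
    fun R₁ h₁ R₂ h₂ S hS => hS.1.2 R₁ (h₁ S hS) R₂ (h₂ S hS)⟩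

variable {X}

theorem ConvSeq.eventually_projRes {ξ : X.Res → X.Res} {R : ℕ → X.Res} (h : X.ConvSeq ξ R)
    (σ : X.Res) : ∀ᶠ n in atTop, X.projRes σ (R n) = ξ σ := by
  have h1 := (tendsto_pi_nhds.1 h) σ
  rw [nhds_discrete, tendsto_pure] at h1
  exact h1

variable (X)

/-- The residue `x'` eventually lies in the convex hull of `x` and `R n`, is its own projection
from `R n`, and contains the chamber `y`. -/
structure IsState (x : X.Res) (R : ℕ → X.Res) (x' : X.Res) (y : X.Chamber) : Prop where
  mem : y ∈ x'.1
  conv : ∀ᶠ n in atTop, x' ∈ X.conv2 x (R n)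
  proj : ∀ᶠ n in atTop, X.projRes x' (R n) = x'

/-- The pair `(x₂, y₂)` lies on the way from `(x₁, y₁)` to `R n`, for all large `n`. -/
structure Reach (R : ℕ → X.Res) (x₁ : X.Res) (y₁ : X.Chamber) (x₂ : X.Res) (y₂ : X.Chamber) :
    Prop where
  par : cs.Par (X.typ x₁) (X.delta y₁ y₂)
  typ_eq : X.typ x₂ = conjSet (X.delta y₁ y₂) (X.typ x₁)
  eventually : ∀ᶠ n in atTop, X.toGate (R n) y₁ = X.delta y₁ y₂ * X.toGate (R n) y₂ ∧
    cs.length (X.toGate (R n) y₁) = cs.length (X.delta y₁ y₂) + cs.length (X.toGate (R n) y₂)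

variable {X} {x : X.Res} {R : ℕ → X.Res}

theorem IsState.eventually_par {x' : X.Res} {y : X.Chamber} (h : X.IsState x R x' y) :
    ∀ᶠ n in atTop, cs.Par (X.typ x') (X.toGate (R n) y) ∧
      ∀ s ∈ X.typ x', (X.toGate (R n) y)⁻¹ * s * X.toGate (R n) y ∈ X.typ (R n) := by
  filter_upwards [h.proj] with n hn
  rw [X.projRes_eq_self_iff x' (R n) h.mem] at hn
  exact ⟨fun s hs => ⟨X.typ_subset _ (hn.2 s hs), hn.1 s (Subgroup.subset_closure hs)⟩, hn.2⟩

theorem Reach.refl (R : ℕ → X.Res) (x' : X.Res) (y : X.Chamber) : X.Reach R x' y x' y where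
  par := by
    rw [delta_self]
    exact CoxeterSystem.Par.one (X.typ_subset x')
  typ_eq := by simp
  eventually := by simp

theorem Reach.delta_eq {x₁ x₂ x₃ : X.Res} {y₁ y₂ y₃ : X.Chamber} (h : X.Reach R x₁ y₁ x₂ y₂)
    (h' : X.Reach R x₂ y₂ x₃ y₃) :
    X.delta y₁ y₃ = X.delta y₁ y₂ * X.delta y₂ y₃ ∧
      cs.length (X.delta y₁ y₃) = cs.length (X.delta y₁ y₂) + cs.length (X.delta y₂ y₃) := by
  obtain ⟨n, ⟨h1, h2⟩, h3, h4⟩ := (h.eventually.and h'.eventually).exists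
  have h5 := cs.length_mul_le (X.delta y₁ y₂ * X.delta y₂ y₃) (X.toGate (R n) y₃)
  have h6 := cs.length_mul_le (X.delta y₁ y₂) (X.delta y₂ y₃)
  rw [mul_assoc, ← h3, ← h1] at h5
  have h7 : cs.length (X.delta y₁ y₂ * X.delta y₂ y₃) =
      cs.length (X.delta y₁ y₂) + cs.length (X.delta y₂ y₃) := by omega
  have h8 := X.delta_add h7
  exact ⟨h8, by rw [h8, h7]⟩

theorem Reach.trans {x₁ x₂ x₃ : X.Res} {y₁ y₂ y₃ : X.Chamber} (h : X.Reach R x₁ y₁ x₂ y₂)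
    (h' : X.Reach R x₂ y₂ x₃ y₃) : X.Reach R x₁ y₁ x₃ y₃ := by
  obtain ⟨h1, h2⟩ := h.delta_eq h'
  refine ⟨?_, ?_, ?_⟩
  · rw [h1]
    exact h.par.mul (h.typ_eq ▸ h'.par)
  · rw [h1, conjSet_mul, ← h.typ_eq, h'.typ_eq]
  · filter_upwards [h.eventually, h'.eventually] with n hn hn'
    rw [h2, hn.2, hn'.2, add_assoc, hn.1, hn'.1, h1, mul_assoc]
    exact ⟨rfl, rfl⟩

theorem isState_of_projection {ξ : X.Res → X.Res} (hR : X.ConvSeq ξ R) {z : X.Res}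
    (hz : ∀ᶠ n in atTop, z ∈ X.conv2 x (R n)) {y : X.Chamber} (hy : y ∈ (ξ z).1) :
    X.IsState x R (ξ z) y where
  mem := hy
  conv := by
    filter_upwards [hz, hR.eventually_projRes z] with n h1 h2
    rw [← h2]
    exact (X.convexResSet_convHull _).2 _ h1 _ (X.mem_convHull (by simp))
  proj := by
    filter_upwards [hR.eventually_projRes z] with n h2
    obtain ⟨c, hc⟩ := X.nonempty_res z
    obtain ⟨_, -, -, -, -, -, -, -, -, h⟩ := X.projRes_spec z (R n) hc
    rw [← h2]
    exact h

/-- One step: enlarge the type of `x'` by a simple reflection `s` and project. -/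
theorem IsState.step {ξ : X.Res → X.Res} (hR : X.ConvSeq ξ R) {x' : X.Res} {y : X.Chamber}
    (h : X.IsState x R x' y) {s : W} (hs : s ∈ cs.S) (hsx : s ∉ X.typ x')
    (hf : (Subgroup.closure (insert s (X.typ x')) : Set W).Finite)
    (hsn : ∃ᶠ n in atTop, s ∈ cs.invSet (X.toGate (R n) y)) :
    ∃ x'' y'', X.IsState x R x'' y'' ∧ X.Reach R x' y x'' y'' ∧
      s ∈ cs.invSet (X.delta y y'') ∧
      X.delta y y'' ∈ Subgroup.closure (insert s (X.typ x')) ∧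
      ∀ᶠ n in atTop, cs.LeftRed (insert s (X.typ x')) (X.toGate (R n) y'') := by
  obtain ⟨J, hJ⟩ : ∃ J, J = X.typ x' := ⟨_, rfl⟩
  rw [← hJ] at hsx hf ⊢
  have hJS : J ⊆ cs.S := hJ ▸ X.typ_subset x'
  have hK : insert s J ⊆ cs.S := Set.insert_subset hs hJS
  obtain ⟨z, hz⟩ : ∃ z : X.Res, z.1 = X.res (insert s J) y :=
    ⟨⟨_, X.isSphResidue_res hK hf y⟩, rfl⟩
  have hyz : y ∈ z.1 := hz ▸ X.mem_res_self _ y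
  have hztyp : X.typ z = insert s J := X.typ_eq hK hz
  have hzx : X.leRes z x' := by
    unfold leRes
    rw [hz, X.eq_res_of_mem x' h.mem, ← hJ]
    exact fun D hD => Subgroup.closure_mono (Set.subset_insert s J) hD
  have hzconv : ∀ᶠ n in atTop, z ∈ X.conv2 x (R n) := by
    filter_upwards [h.conv] with n hn
    exact (X.convexResSet_convHull _).1 _ _ hzx hn
  obtain ⟨y'', hy''⟩ : ∃ y'', y'' = X.gate (ξ z).1 y := ⟨_, rfl⟩
  have hst := isState_of_projection hR hzconv (hy'' ▸ X.gate_mem (ξ z) y)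
  have hev : ∀ᶠ n in atTop, X.toGate (R n) y = X.delta y y'' * X.toGate (R n) y'' ∧
      X.delta y y'' ∈ Subgroup.closure (insert s J) ∧
      cs.LeftRed (insert s J) (X.toGate (R n) y'') ∧
      X.typ (ξ z) = conjInter (insert s J) (X.toGate (R n) y'') (X.typ (R n)) ∧
      cs.LeftRed (X.typ (ξ z)) (X.delta y y'')⁻¹ := by
    filter_upwards [hR.eventually_projRes z] with n h2
    obtain ⟨y₁, h3, -, -, h4, h5, h6, h7, h8, -⟩ := X.projRes_spec z (R n) hyz
    rw [h2] at h3 h7 h8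
    rw [hztyp] at h5 h6 h7
    rw [h3, ← hy''] at h4 h5 h6 h7 h8
    exact ⟨h4, h5, h6, h7, h8⟩
  obtain ⟨n, hsn, ⟨hw, ha, hb, htyp, hred⟩, hpar, hparR⟩ :=
    (hsn.and_eventually (hev.and h.eventually_par)).exists
  rw [← hJ] at hpar hparR
  obtain ⟨a, haa⟩ : ∃ a, a = X.delta y y'' := ⟨_, rfl⟩
  obtain ⟨b, hbb⟩ : ∃ b, b = X.toGate (R n) y'' := ⟨_, rfl⟩
  rw [← haa] at hw ha hred
  rw [← hbb] at hw hb htyp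
  rw [hw] at hsn hpar hparR
  have hsa : s ∈ cs.invSet a :=
    (hb.mem_invSet_mul_iff cs ha (Subgroup.subset_closure (Set.mem_insert s J))).1 hsn
  have hQ := hpar.left_factor hK (Set.subset_insert s J) ha hb
  have hLK : X.typ (ξ z) ⊆ insert s J := htyp ▸ conjInter_subset _ _ _
  have hJL : conjSet a J ⊆ X.typ (ξ z) := by
    intro j hj
    rw [htyp]
    refine ⟨hQ.2 hj, ?_⟩
    have h1 := hparR _ hj
    convert h1 using 1
    group
  have hLK' : X.typ (ξ z) ≠ insert s J := by
    intro h1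
    rw [h1] at hred
    have h2 : a⁻¹ ≠ 1 := by
      intro h3
      rw [inv_eq_one] at h3
      simp [h3] at hsa
    obtain ⟨r, hr, hr'⟩ := cs.exists_mem_invSet_of_mem_closure hK (inv_mem ha) h2
    exact hred r (Subgroup.subset_closure hr) hr'
  have hKf : (insert s J).Finite := hf.subset Subgroup.subset_closure
  have hJf : J.Finite := hKf.subset (Set.subset_insert s J)
  have htyp' : conjSet a J = X.typ (ξ z) := by
    refine Set.eq_of_subset_of_ncard_le hJL ?_ (hKf.subset hLK)
    have h1 := Set.ncard_lt_ncard (hLK.ssubset_of_ne hLK') hKf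
    rw [Set.ncard_insert_of_notMem hsx hJf] at h1
    rw [CoxeterSystem.ncard_conjSet]
    omega
  refine ⟨ξ z, y'', hst, ⟨?_, ?_, ?_⟩, haa ▸ hsa, haa ▸ ha, hev.mono fun n hn => hn.2.2.1⟩
  · rw [← haa, ← hJ]
    exact hQ.1
  · rw [← haa, ← hJ, htyp']
  · filter_upwards [hev] with n hn
    refine ⟨hn.1, ?_⟩
    rw [hn.1]
    exact hn.2.2.1.length_mul cs hK hn.2.1

/-- Every element of `Par` that is frequently an initial piece can be realised. -/
theorem IsState.exists_reach_of_frequently {ξ : X.Res → X.Res} (hR : X.ConvSeq ξ R) {h : W}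
    {x' : X.Res} {y : X.Chamber} (hst : X.IsState x R x' y) (hh : cs.Par (X.typ x') h)
    (hfr : ∃ᶠ n in atTop, cs.invSet h ⊆ cs.invSet (X.toGate (R n) y)) :
    ∃ x'' y'', X.IsState x R x'' y'' ∧ X.Reach R x' y x'' y'' ∧ X.delta y y'' = h := by
  obtain ⟨m, hm⟩ : ∃ m, cs.length h = m := ⟨_, rfl⟩
  induction m using Nat.strong_induction_on generalizing h x' y with
  | _ m ih =>
    by_cases h1 : h = 1
    · exact ⟨x', y, hst, Reach.refl R x' y, by rw [delta_self, h1]⟩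
    have hJS := X.typ_subset x'
    obtain ⟨i, hi⟩ := cs.exists_leftDescent_of_ne_one h1
    obtain ⟨s, hsi⟩ : ∃ s, s = cs.simple i := ⟨_, rfl⟩
    have hs : s ∈ cs.S := ⟨i, hsi.symm⟩
    have hsh : s ∈ cs.invSet h := (cs.mem_invSet_iff (.of_mem_S hs)).2 (hsi ▸ hi)
    have hsJ : s ∉ X.typ x' := fun h2 => (hh s h2).2 hsh
    obtain ⟨wJ, hwJ⟩ := CoxeterSystem.exists_isLongest hJS (X.typ_finite x')
    have hK : insert s (X.typ x') ⊆ cs.S := Set.insert_subset hs hJS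
    obtain ⟨x₁, y₁, hst₁, hre₁, hsa, ha, hb⟩ := hst.step hR hs hsJ
      (hh.step hJS hwJ hs hsJ hsh).2 (hfr.mono fun n hn => hn hsh)
    obtain ⟨a', b', ha', hb', rfl⟩ := cs.exists_leftRed (I := insert s (X.typ x')) h
    have hlen' := hb'.length_mul cs hK ha'
    have haa' : X.delta y y₁ = a' := by
      obtain ⟨n, hn, ⟨hpar, -⟩, hbn, hw, -⟩ :=
        (hfr.and_eventually (hst.eventually_par.and (hb.and hre₁.eventually))).exists
      have h2 := hn hsh
      rw [hw] at hpar h2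
      have h3 := hpar.step_isLongest hJS hwJ hs hsJ h2 ha hbn
      have h4 := hh.step_isLongest hJS hwJ hs hsJ hsh ha' hb'
      exact mul_left_cancel (h3.unique h4)
    have hpar' : cs.Par (X.typ x₁) b' := by
      rw [hre₁.typ_eq, haa']
      exact hh.cancel hJS (haa' ▸ hre₁.par)
    have ha'1 : cs.length a' ≠ 0 := by
      intro h2
      rw [cs.length_eq_zero_iff] at h2
      rw [haa', h2] at hsa
      simp at hsa
    have hfr' : ∃ᶠ n in atTop, cs.invSet b' ⊆ cs.invSet (X.toGate (R n) y₁) := by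
      refine (hfr.and_eventually hre₁.eventually).mono ?_
      rintro n ⟨hn, hw, hl⟩
      rw [cs.invSet_subset_iff] at hn ⊢
      rw [hl, haa', hlen', hw, haa', show (a' * b')⁻¹ * (a' * X.toGate (R n) y₁) =
        b'⁻¹ * X.toGate (R n) y₁ by group] at hn
      omega
    obtain ⟨x₂, y₂, hst₂, hre₂, hd⟩ := ih (cs.length b') (by omega) hst₁ hpar' hfr' rfl
    exact ⟨x₂, y₂, hst₂, hre₁.trans hre₂, by rw [(hre₁.delta_eq hre₂).1, haa', hd]⟩

theorem IsState.exists_reach_mem {ξ : X.Res → X.Res} (hR : X.ConvSeq ξ R) {x' : X.Res}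
    {y : X.Chamber} (hst : X.IsState x R x' y) {t : W}
    (hfr : ∃ᶠ n in atTop, t ∈ cs.invSet (X.toGate (R n) y)) :
    ∃ x'' y'', X.IsState x R x'' y'' ∧ X.Reach R x' y x'' y'' ∧
      t ∈ cs.invSet (X.delta y y'') := by
  obtain ⟨n, hn⟩ := hfr.exists
  have hfin := CoxeterSystem.finite_minPar (X.typ_subset x') (X.typ_finite x')
    (cs.isReflection_of_mem_invSet hn)
  have h1 : ∃ v ∈ cs.minPar (X.typ x') t,
      ∃ᶠ n in atTop, cs.invSet v ⊆ cs.invSet (X.toGate (R n) y) := by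
    by_contra h2
    push Not at h2
    have h3 := (eventually_all_finite hfin).2 fun v hv => h2 v hv
    obtain ⟨n, hn, h4, h5, -⟩ := (hfr.and_eventually (h3.and hst.eventually_par)).exists
    obtain ⟨v, hv, hvw⟩ := CoxeterSystem.exists_mem_minPar h5 hn
    exact h4 v hv hvw
  obtain ⟨v, hv, hvf⟩ := h1
  obtain ⟨x₂, y₂, hst₂, hre₂, hd⟩ := hst.exists_reach_of_frequently hR hv.1 hvf
  exact ⟨x₂, y₂, hst₂, hre₂, hd ▸ hv.2.1⟩

theorem IsState.exists_reach_finite {ξ : X.Res → X.Res} (hR : X.ConvSeq ξ R) {x' : X.Res}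
    {y : X.Chamber} (hst : X.IsState x R x' y) {U : Set W} (hU : U.Finite) :
    ∃ x'' y'', X.IsState x R x'' y'' ∧ X.Reach R x' y x'' y'' ∧
      ∀ t ∈ U, ∀ᶠ n in atTop, t ∈ cs.invSet (X.toGate (R n) y) →
        t ∈ cs.invSet (X.delta y y'') := by
  induction U, hU using Set.Finite.induction_on with
  | empty => exact ⟨x', y, hst, Reach.refl R x' y, by simp⟩
  | @insert u U _ _ ih =>
    obtain ⟨x₁, y₁, hst₁, hre₁, h1⟩ := ih
    by_cases hf : ∃ᶠ n in atTop,
        (X.delta y y₁)⁻¹ * u * X.delta y y₁ ∈ cs.invSet (X.toGate (R n) y₁)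
    · by_cases hu : u ∈ cs.invSet (X.delta y y₁)
      · refine ⟨x₁, y₁, hst₁, hre₁, ?_⟩
        rintro t (rfl | ht)
        · exact Eventually.of_forall fun n _ => hu
        · exact h1 t ht
      · obtain ⟨x₂, y₂, hst₂, hre₂, h2⟩ := hst₁.exists_reach_mem hR hf
        obtain ⟨hd, hl⟩ := hre₁.delta_eq hre₂
        refine ⟨x₂, y₂, hst₂, hre₁.trans hre₂, ?_⟩
        rw [hd] at hl ⊢
        rintro t (rfl | ht)
        · exact Eventually.of_forall fun n _ => (cs.mem_invSet_mul_of_length hl).2 (Or.inr h2)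
        · filter_upwards [h1 t ht] with n hn hn'
          exact (cs.mem_invSet_mul_of_length hl).2 (Or.inl (hn hn'))
    · rw [not_frequently] at hf
      refine ⟨x₁, y₁, hst₁, hre₁, ?_⟩
      rintro t (rfl | ht)
      · filter_upwards [hf, hre₁.eventually] with n hn hw hn'
        rw [hw.1] at hn'
        rw [hw.1] at hw
        rcases (cs.mem_invSet_mul_of_length hw.2).1 hn' with h3 | h3
        · exact h3
        · exact absurd h3 hn
      · exact h1 t ht

end Bldg

namespace Bldg

variable {cs : CoxeterSystem M W} {X : Bldg cs} {α : W → X.Chamber}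

theorem IsApartMap.apply_mul_delta (hα : X.IsApartMap α) {p : W} {C : X.Chamber}
    (hC : C ∈ Set.range α) : α (p * X.delta (α p) C) = C := by
  obtain ⟨q, rfl⟩ := hC
  rw [hα.2, mul_inv_cancel_left]

theorem IsApartMap.apply_mul_eq {α' : W → X.Chamber} (hα : X.IsApartMap α)
    (hα' : X.IsApartMap α') (h : Set.range α = Set.range α') {p p' : W} (hp : α p = α' p')
    (q : W) : α (p * q) = α' (p' * q) := by
  have h1 := hα.2 p (p * q)
  rw [inv_mul_cancel_left] at h1
  have h2 := hα'.apply_mul_delta (p := p') (h.subset ⟨p * q, rfl⟩)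
  rwa [← hp, h1, eq_comm] at h2

/-- Membership in a root of an apartment, as seen from a chamber of the apartment. -/
theorem IsApartMap.exists_mem_root_iff {φ : Set X.Chamber} (hα : X.IsApartMap α)
    (hφ : X.IsRootOf (Set.range α) φ) (p : W) :
    ∃ (t : W) (ε : Prop), cs.IsReflection t ∧
      ∀ q, α (p * q) ∈ φ ↔ (t ∈ cs.invSet q ↔ ε) := by
  obtain ⟨α', hα', hr, t, ht, rfl⟩ := hφ
  obtain ⟨h, hh⟩ : α p ∈ Set.range α' := hr ▸ ⟨p, rfl⟩
  refine ⟨h⁻¹ * t * h, t ∈ cs.invSet h, (cs.isReflection_inv_conj h).2 ht, fun q => ?_⟩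
  rw [hα.apply_mul_eq hα' hr hh.symm, hα'.1.mem_set_image, Set.mem_ofPred_eq]
  have h1 := cs.mem_invSet_mul (v := h) (w := q) (t := t)
  rw [cs.mem_invSet_iff ht] at h1
  have h2 := ht.length_mul_right_ne (h * q)
  have h3 : cs.length (h * q) < cs.length (t * (h * q)) ↔
      ¬ cs.length (t * (h * q)) < cs.length (h * q) := by omega
  rw [h3, h1]
  tauto

/-- The retraction of a residue contains the expected chambers of the apartment. -/
theorem apply_mul_mem_retrRes (hα : X.IsApartMap α) (T : X.Res) {r : X.Chamber} (hr : r ∈ T.1)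
    {u : W} (hu : u ∈ Subgroup.closure (X.typ T)) :
    α (X.delta (α 1) r * u) ∈ (X.retrRes α T).1 := by
  have hex : ∃ U : X.Res, ∃ (I : Set B) (D : X.Chamber),
      T.1 = X.residue I D ∧ U.1 = X.residue I (X.retr α D) := by
    obtain ⟨I, D, hI, h⟩ := T.2
    exact ⟨⟨_, I, X.retr α D, hI, rfl⟩, I, D, h, rfl⟩
  obtain ⟨I, D, hT, hU⟩ := Classical.epsilon_spec hex
  have hI := cs.image_simple_subset I
  rw [X.typ_eq hI hT] at hu
  rw [hT] at hr
  obtain ⟨v, hv, hvr⟩ := X.exists_delta_eq_mul hI (C := α 1) hr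
  change α _ ∈ (Classical.epsilon _ : X.Res).1
  rw [hU]
  change X.delta (α _) (α _) ∈ Subgroup.closure _
  rw [hα.2, hvr, mul_assoc, inv_mul_cancel_left]
  exact mul_mem hv hu

variable {x : X.Res} {R : ℕ → X.Res}

theorem IsApartMap.apply_mul_delta_of_reach (hα : X.IsApartMap α) {x₁ x₂ : X.Res}
    {y₁ y₂ : X.Chamber} {p : W} (hp : α p = y₁) (h : X.Reach R x₁ y₁ x₂ y₂) (hy : y₂ ∈ x₂.1)
    (hA : X.LiesIn x₂ (Set.range α)) : α (p * X.delta y₁ y₂) = y₂ := by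
  obtain ⟨a, ha, haA⟩ := hA
  have hx := X.eq_res_of_mem x₂ hy
  have hS := X.typ_subset x₂
  have hpar := h.par.inv (X.typ_subset x₁)
  rw [← h.typ_eq] at hpar
  have hred := hpar.leftRed hS
  have hgate := X.gate_eq hS (X.mem_res_self _ y₂) hred
  have hya := (X.delta_of_leftRed hS hred (hx ▸ ha)).1
  have haeq := hα.apply_mul_delta (p := p) haA
  refine (X.gate_eq hS (E := α (p * X.delta y₁ y₂)) ?_ ?_).symm.trans hgate
  · rw [← X.res_eq_of_mem hS (hx ▸ ha)]
    apply X.mem_res_symm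
    rw [mem_res, ← haeq, hα.2, hp, hya]
    convert (hx ▸ ha : a ∈ X.res (X.typ x₂) y₂) using 1
    group
    rfl
  · rwa [← hp, hα.2, inv_mul_cancel_left, hp]

theorem IsState.mem_Qseq {x' : X.Res} {y : X.Chamber} (h : X.IsState x R x' y) :
    x' ∈ X.Qseq x R := by
  obtain ⟨k, hk⟩ := eventually_atTop.1 h.conv
  simp only [Qseq, Set.mem_iUnion, Set.mem_iInter]
  exact ⟨k, hk⟩

/-- After passing far enough towards `R`, the distances from a fixed chamber add up. -/
theorem IsState.exists_delta_gate {ξ : X.Res → X.Res} (hR : X.ConvSeq ξ R)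
    (hα : X.IsApartMap α) (hA : ∀ z ∈ X.Qseq x R, X.LiesIn z (Set.range α))
    {x' : X.Res} {y : X.Chamber} (hst : X.IsState x R x' y) (hy : y ∈ Set.range α) :
    ∃ x₁ p, X.IsState x R x₁ (α p) ∧
      ∀ᶠ n in atTop, X.delta (α 1) (X.gate (R n).1 (α p)) = p * X.toGate (R n) (α p) := by
  obtain ⟨p, rfl⟩ := hy
  obtain ⟨x₁, y₁, hst₁, hre, hU⟩ := hst.exists_reach_finite hR (cs.finite_invSet p⁻¹)
  have hy₁ := hα.apply_mul_delta_of_reach rfl hre hst₁.mem (hA _ hst₁.mem_Qseq)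
  obtain ⟨v, hv⟩ : ∃ v, v = X.delta (α p) y₁ := ⟨_, rfl⟩
  rw [← hv] at hy₁ hU
  refine ⟨x₁, p * v, hy₁ ▸ hst₁, ?_⟩
  have hU' := (eventually_all_finite (cs.finite_invSet p⁻¹)).2 hU
  filter_upwards [hU', hre.eventually] with n hn hw
  rw [← hv] at hw
  rw [hy₁]
  have hd : X.delta (α 1) y₁ = p * v := by rw [← hy₁, hα.2, inv_one, one_mul]
  obtain ⟨b, hb⟩ : ∃ b, b = X.toGate (R n) y₁ := ⟨_, rfl⟩
  rw [← hb] at hw ⊢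
  rw [← hd]
  subst hb
  refine X.delta_add ?_
  rw [hd]
  change cs.length (_ * X.toGate (R n) y₁) = _ + cs.length (X.toGate (R n) y₁)
  rw [cs.length_mul_iff]
  intro t ht htb
  have hl := hw.2
  rw [hw.1] at hn hl
  rw [cs.length_mul_iff] at hl
  obtain ⟨s, hs⟩ : ∃ s, s = p⁻¹ * t * p := ⟨_, rfl⟩
  have hvs : (p * v)⁻¹ * t * (p * v) = v⁻¹ * s * v := by rw [hs]; group
  rw [hvs] at htb
  have h1 : s ∉ cs.invSet v := fun h => hl s h htb
  have h2 : t ∈ cs.invSet p := by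
    rw [cs.mem_invSet_mul, ← hs] at ht
    tauto
  have h3 : s ∈ cs.invSet p⁻¹ := by
    rw [cs.mem_invSet_inv, hs]
    convert h2 using 1
    group
  exact h1 (hn s h3 (cs.mem_invSet_mul.2 (by tauto)))

theorem IsState.exists_mem_root {ξ : X.Res → X.Res} (hR : X.ConvSeq ξ R)
    (hα : X.IsApartMap α) (hA : ∀ z ∈ X.Qseq x R, X.LiesIn z (Set.range α))
    {x' : X.Res} {p : W} (hst : X.IsState x R x' (α p))
    (hp : ∀ᶠ n in atTop, X.delta (α 1) (X.gate (R n).1 (α p)) = p * X.toGate (R n) (α p))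
    {ι : Type*} [Finite ι] {φ : ι → Set X.Chamber}
    (hφ : ∀ i, X.IsRootOf (Set.range α) (φ i))
    (hφR : ∀ i, ∀ᶠ n in atTop, X.ContainedInRoot (X.retrRes α (R n)) (Set.range α) (φ i)) :
    ∃ z ∈ X.Qseq x R, ∀ i, X.ContainedInRoot z (Set.range α) (φ i) := by
  choose t ε ht hmem using fun i => hα.exists_mem_root_iff (hφ i) p
  obtain ⟨z, y, hst', hre, hU⟩ := hst.exists_reach_finite hR (Set.finite_range t)
  have hy := hα.apply_mul_delta_of_reach rfl hre hst'.mem (hA _ hst'.mem_Qseq)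
  refine ⟨z, hst'.mem_Qseq, fun i => ?_⟩
  rintro C ⟨hCz, q, rfl⟩
  obtain ⟨n, hn, hpn, hRn, hpar, hw⟩ := ((hU (t i) ⟨i, rfl⟩).and (hp.and
    ((hφR i).and (hst.eventually_par.and hre.eventually)))).exists
  obtain ⟨v, hv⟩ : ∃ v, v = X.delta (α p) y := ⟨_, rfl⟩
  obtain ⟨w, hww⟩ : ∃ w, w = X.toGate (R n) (α p) := ⟨_, rfl⟩
  have htyp := hre.typ_eq
  rw [← hv] at hy hn hw htyp
  rw [← hww] at hpn hpar hn hw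
  have hside : ∀ u ∈ Subgroup.closure (X.typ (R n)), (t i ∈ cs.invSet (w * u) ↔ ε i) := by
    intro u hu
    rw [← hmem, ← mul_assoc, ← hpn]
    exact hRn ⟨apply_mul_mem_retrRes hα _ (X.gate_mem _ _) hu, _, rfl⟩
  have hvw : t i ∈ cs.invSet v ↔ t i ∈ cs.invSet w := by
    refine ⟨fun h => ?_, hn⟩
    have hl := hw.2
    rw [hw.1] at hl ⊢
    exact (cs.mem_invSet_mul_of_length hl).2 (Or.inl h)
  have hw1 : t i ∈ cs.invSet w ↔ ε i := by simpa using hside 1 (one_mem _)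
  have hq : v⁻¹ * p⁻¹ * q ∈ Subgroup.closure (X.typ z) := by
    have h1 := X.eq_res_of_mem z hst'.mem ▸ hCz
    rw [mem_res, ← hy, hα.2] at h1
    convert h1 using 1
    group
  have hqe : q = p * (v * (v⁻¹ * p⁻¹ * q)) := by group
  rw [hqe, hmem, cs.mem_invSet_mul, hvw, hw1]
  have hnot : v⁻¹ * t i * v ∉ cs.invSet (v⁻¹ * p⁻¹ * q) := by
    intro h
    have h1 := cs.invSet_subset_closure (X.typ_subset z) hq h
    rw [htyp, SetLike.mem_coe, inv_conj_mem_closure_conjSet] at h1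
    have h2 : w⁻¹ * t i * w ∈ Subgroup.closure (X.typ (R n)) := by
      generalize t i = r at h1 ⊢
      induction h1 using Subgroup.closure_induction with
      | mem s hs => exact Subgroup.subset_closure (hpar.2 s hs)
      | one => simp
      | mul a b _ _ ha hb =>
        convert mul_mem ha hb using 1
        group
      | inv a _ ha =>
        convert inv_mem ha using 1
        group
    have h3 := hside _ h2
    rw [show w * (w⁻¹ * t i * w) = t i * w by group, cs.mem_invSet_mul] at h3
    simp only [(ht i).mem_invSet_self, inv_mul_cancel, one_mul, true_iff] at h3
    tauto
  tauto

end Bldg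

/-- given `x ∈ Res(X)`, `ξ ∈ Cr(X)` and an apartment `A` containing
`Q(x,ξ)`, for all roots `α₁,…,αₙ ∈ Φ_A(ξ)` the set of residues of `Q(x,ξ)`
contained in each `αᵢ` is non-empty. -/
theorem statement11 {cs : CoxeterSystem M W} (X : Bldg cs)
    (ξ : X.Res → X.Res) (hξ : ξ ∈ X.Cr) (hseq : ∃ R : ℕ → X.Res, X.ConvSeq ξ R)
    (x : X.Res)
    (A : Set X.Chamber) (α : W → X.Chamber) (hα : X.IsApartMap α) (hAα : A = Set.range α)
    (hQA : ∀ R ∈ X.Qsector x ξ, X.LiesIn R A)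
    (n : ℕ) (αs : Fin n → Set X.Chamber) (hαs : ∀ i, αs i ∈ X.PhiXi A α ξ) :
    (X.Qsector x ξ ∩ {R : X.Res | ∀ i, X.ContainedInRoot R A (αs i)}).Nonempty := by
  subst hAα
  have hR := Classical.epsilon_spec hseq
  obtain ⟨y', hy'⟩ := X.nonempty_res (ξ x)
  have hx : ∀ y ∈ (ξ x).1, X.IsState x (Classical.epsilon (X.ConvSeq ξ)) (ξ x) y := fun y hy =>
    Bldg.isState_of_projection hR (Eventually.of_forall fun n => X.mem_convHull (by simp)) hy
  obtain ⟨y, hy, hyA⟩ := hQA _ (hx y' hy').mem_Qseq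
  obtain ⟨x₁, p, hst, hp⟩ := (hx y hy).exists_delta_gate hR hα hQA hyA
  obtain ⟨z, hz, hzφ⟩ := hst.exists_mem_root hR hα hQA hp (fun i => (hαs i).1) fun i => by
    obtain ⟨N, hN⟩ := (hαs i).2 _ hR
    exact (eventually_gt_atTop N).mono hN
  exact ⟨z, hz, hzφ⟩
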